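/- For every integer d ≥ 2 there exists a constant C_d > 0, depending only on d, with the following property. Let p > d be a prime, let f ∈ ℤ[X] have degree d, let m ≥ 1, and suppose that in K[X] the derivative factors completely as f'(X) = a · ∏_{ξ∈R} (X − ξ)^{e_ξ}, where R ⊆ K is the finite set of distinct roots of f', each e_ξ ≥ 1, and a is the leading coefficient of f'. Then |S_m(f)| ≤ C_d · max_{ξ∈R} min_{C : ξ∈C⊆R} ( p^{-m} / |a · ∏_{η∈R∖C} (ξ − η)^{e_η}| )^{1/(S(C)+1)}, where the minimum is over all subsets C of R containing ξ and S(C) = Σ_{η∈C} e_η. -/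

import Mathlib

open Polynomial

/-- The normalized complete exponential sum `S_m(f) = p^{-m} ∑_{x=0}^{p^m-1} e^{2πi f(x)/p^m}`. -/
noncomputable def expSum (p m : ℕ) (f : Polynomial ℤ) : ℂ :=
  ((p : ℂ) ^ m)⁻¹ * ∑ x ∈ Finset.range (p ^ m),
    Complex.exp (2 * (Real.pi : ℂ) * Complex.I * ((f.eval (x : ℤ) : ℤ) : ℂ) / (p : ℂ) ^ m)

theorem natDegree_sum_pow_prime_pow {F : Type*} [Field F] {p : ℕ} (hp : 1 < p) (g : F[X])
    (hg : 0 < g.natDegree) (n : ℕ) :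
    (∑ i ∈ Finset.range (n + 1), g ^ p ^ i).natDegree = p ^ n * g.natDegree := by
  induction n with
  | zero => simp
  | succ n ih =>
    rw [Finset.sum_range_succ, natDegree_add_eq_right_of_natDegree_lt, natDegree_pow]
    rw [ih, natDegree_pow]
    exact Nat.mul_lt_mul_of_pos_right (Nat.pow_lt_pow_right hp n.lt_succ_self) hg

theorem sum_smul_ne_zero_of_injective_natDegree {F ι : Type*} [Field F] [Fintype ι] (B : ι → F[X])
    (hB : ∀ i, B i ≠ 0) (hinj : Function.Injective fun i => (B i).natDegree) (c : ι → F)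
    (hc : c ≠ 0) : ∑ i, c i • B i ≠ 0 := by
  intro h0
  have key := degree_sum_eq_of_disjoint (fun i => c i • B i) Finset.univ (by
    intro i hi j hj hij heq
    have hi0 : c i ≠ 0 := fun h => hi.2 (by simp [h])
    have hj0 : c j ≠ 0 := fun h => hj.2 (by simp [h])
    simp only [Function.comp] at heq
    rw [smul_eq_C_mul, smul_eq_C_mul, degree_C_mul hi0, degree_C_mul hj0] at heq
    exact hij (hinj (natDegree_eq_of_degree_eq heq)))
  rw [h0, degree_zero] at key
  apply hc
  funext i
  have := (Finset.sup_eq_bot_iff _ _).1 key.symm i (Finset.mem_univ i)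
  rw [degree_eq_bot, smul_eq_zero] at this
  exact this.resolve_right (hB i)

theorem stepanov_monomial_degree_injective {A I p d : ℕ} (hpd : Nat.Coprime p d) :
    Function.Injective fun t : Fin I × Fin p × Fin A =>
      (t.2.2 : ℕ) + t.1 * (p * A) + t.2.1 * (A * d) := by
  rintro ⟨i, j, k⟩ ⟨i', j', k'⟩ h
  have hA : 0 < A := lt_of_le_of_lt (Nat.zero_le _) k.2
  simp only at h
  have e1 : (k : ℕ) + A * (p * i + d * j) = k' + A * (p * i' + d * j') := by linarith
  have hk : (k : ℕ) = k' := by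
    have := congrArg (· % A) e1
    simpa [Nat.mod_eq_of_lt k.2, Nat.mod_eq_of_lt k'.2] using this
  have e2 : p * (i : ℕ) + d * j = p * i' + d * j' := by
    rw [hk] at e1
    exact Nat.eq_of_mul_eq_mul_left hA (Nat.add_left_cancel e1)
  have hj : (j : ℕ) = j' := by
    have h1 : d * j ≡ d * j' [MOD p] := by
      have := congrArg (· % p) e2
      simpa [Nat.ModEq, Nat.add_mod] using this
    have h2 := Nat.ModEq.cancel_left_of_coprime hpd h1
    exact Nat.ModEq.eq_of_lt_of_lt h2 j.2 j'.2
  have hp : 0 < p := lt_of_le_of_lt (Nat.zero_le _) j.2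
  have hi : (i : ℕ) = i' := by
    rw [hj] at e2
    exact Nat.eq_of_mul_eq_mul_left hp (Nat.add_right_cancel e2)
  ext <;> assumption

/-- Stepanov's bound for the number of points of `𝔽_{p^{2b+2}}` at which `g` has prescribed
absolute trace. -/
theorem card_trace_eq_le {p : ℕ} [Fact p.Prime] {Ω : Type*} [Field Ω] [Algebra (ZMod p) Ω]
    (g : (ZMod p)[X]) (hg : ¬ p ∣ g.natDegree) (b : ℕ) (c : ZMod p) (s : Finset Ω)
    (hs : ∀ α ∈ s, α ^ p ^ (2 * (b + 1)) = α ∧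
      ∑ i ∈ Finset.range (2 * (b + 1)), (aeval α g) ^ p ^ i = algebraMap (ZMod p) Ω c) :
    s.card ≤ p ^ (2 * b + 1) + (3 * g.natDegree + 5) * p ^ (b + 1) := by
  classical
  have hp : p.Prime := Fact.out
  set d := g.natDegree with hd
  have hd0 : 0 < d := Nat.pos_of_ne_zero fun h => hg (h ▸ dvd_zero p)
  set A := p ^ b with hA
  have hA0 : 0 < A := pow_pos hp.pos _
  set Q := p * A with hQ
  have hQp : Q = p ^ (b + 1) := by rw [hQ, hA, pow_succ]; ring
  set I := A + 2 * d + 4 with hI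
  set V : (ZMod p)[X] := ∑ i ∈ Finset.range (b + 1), g ^ p ^ i with hV
  have hVd : V.natDegree = A * d := natDegree_sum_pow_prime_pow hp.one_lt g hd0 b
  have hV0 : V ≠ 0 := by
    intro h
    rw [h, natDegree_zero] at hVd
    exact (Nat.mul_pos hA0 hd0).ne hVd
  set W : Fin I × Fin p × Fin A → (ZMod p)[X] := fun t =>
    X ^ ((t.2.2 : ℕ) * Q + t.1) * (C c - V) ^ (t.2.1 : ℕ) with hW
  set B : Fin I × Fin p × Fin A → (ZMod p)[X] := fun t =>
    X ^ ((t.2.2 : ℕ) + t.1 * Q) * V ^ (t.2.1 : ℕ) with hB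
  set E := Q * A + I + d * Q with hE
  have hcVd : (C c - V).natDegree ≤ A * d :=
    (natDegree_sub_le _ _).trans (by simp [hVd])
  have hWmem : ∀ t, W t ∈ degreeLT (ZMod p) E := by
    intro t
    rw [mem_degreeLT]
    refine lt_of_le_of_lt degree_le_natDegree ?_
    rw [Nat.cast_lt]
    have h1 : (W t).natDegree ≤ ((t.2.2 : ℕ) * Q + t.1) + t.2.1 * (A * d) := by
      refine natDegree_mul_le.trans (add_le_add (natDegree_X_pow _).le ?_)
      exact natDegree_pow_le.trans (Nat.mul_le_mul_left _ hcVd)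
    refine lt_of_le_of_lt h1 ?_
    have h2 : (t.2.2 : ℕ) * Q ≤ A * Q := Nat.mul_le_mul_right _ t.2.2.2.le
    have h3 : (t.2.1 : ℕ) * (A * d) ≤ p * (A * d) := Nat.mul_le_mul_right _ t.2.1.2.le
    have h4 := t.1.2
    have h5 : p * (A * d) = d * Q := by rw [hQ]; ring
    rw [hE]
    linarith
  have hcard : E < Fintype.card (Fin I × Fin p × Fin A) := by
    simp only [Fintype.card_prod, Fintype.card_fin]
    have h5 : I * (p * A) = I * Q := rfl
    rw [h5, hE, hI]
    have h6 : A ≤ Q := Nat.le_mul_of_pos_left _ hp.pos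
    have h7 : 2 * (d + 3) ≤ Q * (d + 3) :=
      Nat.mul_le_mul_right _ (hp.two_le.trans (Nat.le_mul_of_pos_right _ hA0))
    nlinarith
  obtain ⟨a, ha, ha0⟩ : ∃ a : Fin I × Fin p × Fin A → ZMod p, ∑ t, a t • W t = 0 ∧ a ≠ 0 := by
    have hli : ¬ LinearIndependent (ZMod p) (fun t => (⟨W t, hWmem t⟩ : degreeLT (ZMod p) E)) := by
      intro hli
      have := hli.fintype_card_le_finrank
      rw [(degreeLTEquiv (ZMod p) E).finrank_eq, Module.finrank_fin_fun] at this
      omega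
    rw [Fintype.not_linearIndependent_iff] at hli
    obtain ⟨a, h1, i, hi⟩ := hli
    refine ⟨a, ?_, fun h => hi (by simp [h])⟩
    have := congrArg Subtype.val h1
    simpa using this
  set h : (ZMod p)[X] := ∑ t, a t • B t with hh
  have hBd : ∀ t, (B t).natDegree = (t.2.2 : ℕ) + t.1 * (p * A) + t.2.1 * (A * d) := by
    intro t
    rw [hB]
    simp only
    rw [natDegree_mul (pow_ne_zero _ X_ne_zero) (pow_ne_zero _ hV0), natDegree_X_pow,
      natDegree_pow, hVd]
  have hh0 : h ≠ 0 := by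
    refine sum_smul_ne_zero_of_injective_natDegree B
      (fun t => mul_ne_zero (pow_ne_zero _ X_ne_zero) (pow_ne_zero _ hV0)) ?_ a ha0
    simp only [hBd]
    exact stepanov_monomial_degree_injective ((Nat.Prime.coprime_iff_not_dvd hp).2 hg)
  have hhd : h.natDegree ≤ p ^ (2 * b + 1) + (3 * d + 5) * p ^ (b + 1) := by
    refine natDegree_sum_le_of_forall_le _ _ fun t _ => ?_
    refine (natDegree_smul_le _ _).trans ?_
    rw [hBd]
    have h2 : (t.1 : ℕ) * Q ≤ I * Q := Nat.mul_le_mul_right _ t.1.2.le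
    have h3 : (t.2.1 : ℕ) * (A * d) ≤ p * (A * d) := Nat.mul_le_mul_right _ t.2.1.2.le
    have h4 := t.2.2.2
    have h5 : p * (A * d) = d * Q := by rw [hQ]; ring
    have h6 : A ≤ Q := Nat.le_mul_of_pos_left _ hp.pos
    have h7 : p ^ (2 * b + 1) = A * Q := by rw [hQ, hA]; ring
    rw [h7, ← hQp, ← hQ]
    have h8 : I * Q = A * Q + 2 * d * Q + 4 * Q := by rw [hI]; ring
    linarith
  have hchar : CharP Ω p := charP_of_injective_algebraMap (algebraMap (ZMod p) Ω).injective p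
  have hroot : ∀ α ∈ s, aeval α h = 0 := by
    intro α hα
    obtain ⟨h1, h2⟩ := hs α hα
    have hVα : (aeval α V) ^ Q = algebraMap (ZMod p) Ω c - aeval α V := by
      rw [← h2, two_mul, Finset.sum_range_add, hV, map_sum, hQp, sum_pow_char_pow]
      simp only [map_pow, add_sub_cancel_left]
      exact Finset.sum_congr rfl fun i _ => by rw [← pow_mul, ← pow_add, add_comm i]
    have hzero : (aeval α h) ^ Q = 0 := by
      have h3 : aeval α (∑ t, a t • W t) = 0 := by rw [ha, map_zero]
      rw [← h3, hh, map_sum, map_sum, hQp, sum_pow_char_pow]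
      refine Finset.sum_congr rfl fun t _ => ?_
      rw [← hQp, map_smul, map_smul, Algebra.smul_def, Algebra.smul_def, mul_pow]
      congr 1
      · rw [← map_pow, hQp, ZMod.pow_card_pow]
      · simp only [hB, hW, map_mul, map_pow, aeval_X, map_sub, aeval_C]
        rw [mul_pow, ← pow_mul, ← pow_mul, mul_comm (t.2.1 : ℕ) Q, pow_mul _ Q, hVα]
        congr 1
        have : ((t.2.2 : ℕ) + t.1 * Q) * Q = t.2.2 * Q + p ^ (2 * (b + 1)) * t.1 := by
          rw [hQp]; ring
        rw [this, pow_add, pow_add, pow_mul _ (p ^ _), h1]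
    exact pow_eq_zero_iff (Nat.mul_pos hp.pos hA0).ne' |>.1 hzero
  refine le_trans ?_ hhd
  have hmap0 : h.map (algebraMap (ZMod p) Ω) ≠ 0 :=
    (Polynomial.map_ne_zero_iff (algebraMap (ZMod p) Ω).injective).2 hh0
  calc s.card ≤ (h.map (algebraMap (ZMod p) Ω)).roots.toFinset.card := by
        refine Finset.card_le_card fun α hα => ?_
        rw [Multiset.mem_toFinset, mem_roots hmap0, IsRoot, eval_map_algebraMap]
        exact hroot α hα
    _ ≤ _ := Multiset.toFinset_card_le _
    _ ≤ _ := card_roots' _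
    _ = _ := natDegree_map _

/-- The generating series `∑ pₖ Tᵏ` of the power sums `pₖ` of the roots of a monic polynomial. -/
noncomputable def powerSumSeries {F : Type*} [Field F] (h : F[X]) : PowerSeries F :=
  (h.natDegree : PowerSeries F) -
    PowerSeries.X * ((derivative h.reverse : F[X]) : PowerSeries F) *
      (h.reverse : PowerSeries F)⁻¹

theorem constantCoeff_coe_reverse {F : Type*} [Field F] {h : F[X]} (hh : h.Monic) :
    PowerSeries.constantCoeff (h.reverse : PowerSeries F) = 1 := by
  rw [Polynomial.constantCoeff_coe, coeff_zero_reverse, hh.leadingCoeff]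

theorem coe_reverse_ne_zero {F : Type*} [Field F] {h : F[X]} (hh : h.Monic) :
    (h.reverse : PowerSeries F) ≠ 0 := by
  intro h0
  have := constantCoeff_coe_reverse hh
  simp [h0] at this

theorem coe_reverse_mul_inv {F : Type*} [Field F] {h : F[X]} (hh : h.Monic) :
    (h.reverse : PowerSeries F) * (h.reverse : PowerSeries F)⁻¹ = 1 :=
  PowerSeries.mul_inv_cancel _ (by rw [constantCoeff_coe_reverse hh]; exact one_ne_zero)

theorem powerSumSeries_mul_reverse {F : Type*} [Field F] {h : F[X]} (hh : h.Monic) :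
    powerSumSeries h * (h.reverse : PowerSeries F) =
      (h.natDegree : PowerSeries F) * (h.reverse : PowerSeries F) -
        PowerSeries.X * ((derivative h.reverse : F[X]) : PowerSeries F) := by
  have := coe_reverse_mul_inv hh
  rw [powerSumSeries]
  linear_combination
    (-PowerSeries.X * ((derivative h.reverse : F[X]) : PowerSeries F)) * this

theorem powerSumSeries_one {F : Type*} [Field F] : powerSumSeries (1 : F[X]) = 0 := by
  have : (1 : F[X]).reverse = 1 := by simpa using reverse_C (1 : F)
  simp [powerSumSeries, this]

theorem powerSumSeries_mul {F : Type*} [Field F] {h k : F[X]} (hh : h.Monic) (hk : k.Monic) :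
    powerSumSeries (h * k) = powerSumSeries h + powerSumSeries k := by
  have e := powerSumSeries_mul_reverse (hh.mul hk)
  have eh := powerSumSeries_mul_reverse hh
  have ek := powerSumSeries_mul_reverse hk
  refine mul_right_cancel₀ (coe_reverse_ne_zero (hh.mul hk)) ?_
  rw [e, hh.natDegree_mul hk, reverse_mul_of_domain, derivative_mul]
  push_cast
  linear_combination (-(k.reverse : PowerSeries F)) * eh - (h.reverse : PowerSeries F) * ek

theorem powerSumSeries_map {F E : Type*} [Field F] [Field E] (φ : F →+* E) {h : F[X]}
    (hh : h.Monic) :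
    powerSumSeries (h.map φ) = PowerSeries.map φ (powerSumSeries h) := by
  have hrev : (h.map φ).reverse = h.reverse.map φ := by
    rw [reverse, reverse, natDegree_map, reflect_map]
  refine mul_right_cancel₀ (coe_reverse_ne_zero (hh.map φ)) ?_
  rw [powerSumSeries_mul_reverse (hh.map φ), hrev, natDegree_map, derivative_map,
    polynomial_map_coe, polynomial_map_coe, ← map_mul, powerSumSeries_mul_reverse hh]
  simp

theorem coeff_powerSumSeries_X_sub_C {F : Type*} [Field F] (α : F) (k : ℕ) :
    PowerSeries.coeff k (powerSumSeries (X - C α)) = α ^ k := by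
  have hrev : (X - C α).reverse = 1 - C α * X := by
    rw [reverse, natDegree_X_sub_C, reflect_sub, reflect_C]
    have : reflect 1 (X : F[X]) = 1 := by
      simpa only [revAt_le le_rfl, pow_one, Nat.sub_self, pow_zero] using
        reflect_monomial (R := F) 1 1
    rw [this, pow_one]
  have e := powerSumSeries_mul_reverse (monic_X_sub_C α)
  rw [hrev, natDegree_X_sub_C] at e
  have e1 : powerSumSeries (X - C α) * (1 - PowerSeries.C α * PowerSeries.X) = 1 := by
    rw [coe_sub, coe_mul, coe_one, coe_C, coe_X, derivative_sub, derivative_one, derivative_mul,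
      derivative_C, derivative_X, zero_mul, mul_one, zero_add, zero_sub, coe_neg, coe_C] at e
    rw [e, Nat.cast_one]
    ring
  induction k with
  | zero =>
    have := congrArg (PowerSeries.coeff 0) e1
    simpa [mul_sub] using this
  | succ k ih =>
    have := congrArg (PowerSeries.coeff (k + 1)) e1
    rw [mul_sub, mul_one, mul_comm (PowerSeries.C α), ← mul_assoc, map_sub,
      PowerSeries.coeff_mul_C, PowerSeries.coeff_succ_mul_X, ih, PowerSeries.coeff_one] at this
    simp only [Nat.add_eq_zero_iff, one_ne_zero, and_false, if_false] at this
    rw [pow_succ]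
    exact sub_eq_zero.1 this

theorem coeff_powerSumSeries_prod {F ι : Type*} [Field F] (s : Finset ι) (x : ι → F) (k : ℕ) :
    PowerSeries.coeff k (powerSumSeries (∏ i ∈ s, (X - C (x i)))) = ∑ i ∈ s, x i ^ k := by
  classical
  induction s using Finset.induction_on with
  | empty => simp [powerSumSeries_one]
  | insert i s hi ih =>
    rw [Finset.prod_insert hi, Finset.sum_insert hi,
      powerSumSeries_mul (monic_X_sub_C _) (monic_prod_of_monic _ _ fun j _ => monic_X_sub_C _),
      map_add, coeff_powerSumSeries_X_sub_C, ih]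

/-- The sum of the values of `g` at the roots of the monic polynomial `h`. -/
noncomputable def rootSum {F : Type*} [Field F] (g h : F[X]) : F :=
  ∑ k ∈ Finset.range (g.natDegree + 1), g.coeff k * PowerSeries.coeff k (powerSumSeries h)

theorem rootSum_one {F : Type*} [Field F] (g : F[X]) : rootSum g 1 = 0 := by
  simp [rootSum, powerSumSeries_one]

theorem rootSum_mul {F : Type*} [Field F] (g : F[X]) {h k : F[X]} (hh : h.Monic) (hk : k.Monic) :
    rootSum g (h * k) = rootSum g h + rootSum g k := by
  simp only [rootSum, powerSumSeries_mul hh hk, map_add, mul_add, Finset.sum_add_distrib]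

theorem rootSum_pow {F : Type*} [Field F] (g : F[X]) {h : F[X]} (hh : h.Monic) (n : ℕ) :
    rootSum g (h ^ n) = n * rootSum g h := by
  induction n with
  | zero => simp [rootSum_one]
  | succ n ih => rw [pow_succ, rootSum_mul g (hh.pow n) hh, ih]; push_cast; ring

theorem rootSum_map_prod {F E ι : Type*} [Field F] [Field E] [Algebra F E] (g h : F[X])
    (hh : h.Monic) (s : Finset ι) (x : ι → E)
    (hx : h.map (algebraMap F E) = ∏ i ∈ s, (X - C (x i))) :
    algebraMap F E (rootSum g h) = ∑ i ∈ s, aeval (x i) g := by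
  simp only [rootSum, map_sum, map_mul, aeval_eq_sum_range, Algebra.smul_def]
  rw [Finset.sum_comm]
  refine Finset.sum_congr rfl fun k _ => ?_
  rw [← Finset.mul_sum, ← coeff_powerSumSeries_prod, ← hx, powerSumSeries_map _ hh,
    PowerSeries.coeff_map]

/-- Changing the `natDegree g`-th elementary symmetric function of the roots of `h` changes the
root sum of `g` linearly. -/
theorem rootSum_add_C_mul_X_pow {F : Type*} [Field F] (g h : F[X]) (hg : 0 < g.natDegree)
    (hh : h.Monic) (hd : g.natDegree ≤ h.natDegree) (t : F) :
    rootSum g (h + C t * X ^ (h.natDegree - g.natDegree)) =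
      rootSum g h - t * g.natDegree * g.leadingCoeff := by
  set d := g.natDegree with hdef
  set n := h.natDegree with hn
  set h' := h + C t * X ^ (n - d) with hh'
  have hdeg : (C t * X ^ (n - d)).degree < h.degree := by
    refine (degree_C_mul_X_pow_le _ _).trans_lt ?_
    rw [degree_eq_natDegree hh.ne_zero, Nat.cast_lt]
    omega
  have hm : h'.Monic := hh.add_of_left hdeg
  have hn' : h'.natDegree = n := natDegree_add_eq_left_of_degree_lt hdeg
  have hrev : h'.reverse = h.reverse + C t * X ^ d := by
    rw [reverse, hn', hh', reflect_add, reflect_C_mul_X_pow, reverse, ← hn, revAt_le (by omega)]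
    congr 3
    omega
  set u : PowerSeries F := (h.reverse : PowerSeries F) with hu
  set u' : PowerSeries F := (h'.reverse : PowerSeries F) with hu'
  set w : PowerSeries F := (((d : F[X]) * h.reverse - X * derivative h.reverse : F[X]) :
    PowerSeries F) * (u⁻¹ * u'⁻¹) with hw
  have hcast : ∀ k : ℕ, ((k : F[X]) : PowerSeries F) = k :=
    map_natCast coeToPowerSeries.ringHom
  have key : powerSumSeries h' = powerSumSeries h -
      PowerSeries.X ^ d * (PowerSeries.C t * w) := by
    have e := powerSumSeries_mul_reverse hm
    have eh := powerSumSeries_mul_reverse hh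
    have hi := coe_reverse_mul_inv hh
    have hi' := coe_reverse_mul_inv hm
    refine mul_right_cancel₀ (mul_ne_zero (coe_reverse_ne_zero hm) (coe_reverse_ne_zero hh)) ?_
    have hww : w * (u' * u) = (((d : F[X]) * h.reverse - X * derivative h.reverse : F[X]) :
        PowerSeries F) := by
      rw [hw]
      linear_combination (((d : F[X]) * h.reverse - X * derivative h.reverse : F[X]) :
        PowerSeries F) * (u * u⁻¹) * hi' + (((d : F[X]) * h.reverse - X * derivative h.reverse : F[X]) :
        PowerSeries F) * hi
    rw [hn', ← hu'] at e
    rw [← hn, ← hu] at eh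
    have hrevP : u' = u + PowerSeries.C t * PowerSeries.X ^ d := by
      rw [hu', hrev]; simp [hu]
    have hder : ((derivative h'.reverse : F[X]) : PowerSeries F) =
        ((derivative h.reverse : F[X]) : PowerSeries F) +
          PowerSeries.C t * ((d : PowerSeries F) * PowerSeries.X ^ (d - 1)) := by
      rw [hrev]; simp [derivative_X_pow, hcast (d : ℕ)]
    have hX : (PowerSeries.X : PowerSeries F) * PowerSeries.X ^ (d - 1) = PowerSeries.X ^ d := by
      rw [← pow_succ']; congr 1; omega
    have hww' : w * (u' * u) = (d : PowerSeries F) * u - PowerSeries.X *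
        ((derivative h.reverse : F[X]) : PowerSeries F) := by
      rw [hww]; simp [hu, hcast d]
    rw [hder] at e
    linear_combination u * e - u' * eh + PowerSeries.X ^ d * PowerSeries.C t * hww' +
      (- PowerSeries.C t * d * u) * hX + (PowerSeries.X * ((derivative h.reverse : F[X]) : PowerSeries F)) * hrevP
  have hw0 : PowerSeries.constantCoeff w = d := by
    rw [hw]
    simp only [map_mul, PowerSeries.constantCoeff_inv, hu, hu', constantCoeff_coe_reverse hh,
      constantCoeff_coe_reverse hm]
    rw [Polynomial.constantCoeff_coe]
    simp [coeff_zero_reverse, hh.leadingCoeff]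
  rw [rootSum, rootSum, ← hdef, Finset.sum_range_succ, Finset.sum_range_succ _ d, key]
  have hlow : ∀ k ∈ Finset.range d, g.coeff k * PowerSeries.coeff k (powerSumSeries h -
      PowerSeries.X ^ d * (PowerSeries.C t * w)) =
      g.coeff k * PowerSeries.coeff k (powerSumSeries h) := by
    intro k hk
    rw [map_sub, PowerSeries.coeff_X_pow_mul', if_neg (by simpa using hk), sub_zero]
  rw [Finset.sum_congr rfl hlow, map_sub, PowerSeries.coeff_X_pow_mul', if_pos le_rfl,
    Nat.sub_self, PowerSeries.coeff_zero_eq_constantCoeff_apply, map_mul, hw0,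
    PowerSeries.constantCoeff_C, leadingCoeff, ← hdef]
  ring

theorem sum_range_mul_of_periodic {M : Type*} [AddCommMonoid M] (φ : ℕ → M) (N : ℕ)
    (hφ : Function.Periodic φ N) (m : ℕ) :
    ∑ i ∈ Finset.range (m * N), φ i = m • ∑ i ∈ Finset.range N, φ i := by
  induction m with
  | zero => simp
  | succ m ih =>
    rw [add_mul, one_mul, Finset.sum_range_add, ih, succ_nsmul]
    congr 1
    refine Finset.sum_congr rfl fun i _ => ?_
    rw [add_comm]
    exact hφ.nat_mul m i

theorem finite_setOf_monic_natDegree_eq (F : Type*) [Field F] [Finite F] (n : ℕ) :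
    {h : F[X] | h.Monic ∧ h.natDegree = n}.Finite := by
  have : Finite (degreeLT F n) := Finite.of_equiv _ (degreeLTEquiv F n).toEquiv.symm
  have : Finite {h : F[X] // h.Monic ∧ h.natDegree = n} :=
    Finite.of_equiv _ (monicEquivDegreeLT n).symm
  refine Set.finite_coe_iff.1 (Finite.of_injective
    (fun x => (⟨x.1, x.2⟩ : {h : F[X] // h.Monic ∧ h.natDegree = n})) fun x y hxy => ?_)
  simpa [Subtype.ext_iff] using hxy

/-- The monic polynomials of degree `n` over a finite field. -/
noncomputable def monicOfDegree (F : Type*) [Field F] [Finite F] (n : ℕ) : Finset F[X] :=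
  (finite_setOf_monic_natDegree_eq F n).toFinset

theorem mem_monicOfDegree {F : Type*} [Field F] [Finite F] {n : ℕ} {h : F[X]} :
    h ∈ monicOfDegree F n ↔ h.Monic ∧ h.natDegree = n := by
  rw [monicOfDegree, Set.Finite.mem_toFinset, Set.mem_ofPred_eq]

/-- The coefficients of the `L`-function attached to `ψ` and `g`. -/
noncomputable def lCoeff {F : Type*} [Field F] [Finite F] (ψ : AddChar F ℂ) (g : F[X])
    (n : ℕ) : ℂ :=
  ∑ h ∈ monicOfDegree F n, ψ (rootSum g h)

theorem lCoeff_zero {F : Type*} [Field F] [Finite F] (ψ : AddChar F ℂ) (g : F[X]) :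
    lCoeff ψ g 0 = 1 := by
  have : monicOfDegree F 0 = {1} := by
    ext h
    rw [mem_monicOfDegree, Finset.mem_singleton]
    exact ⟨fun ⟨h1, h2⟩ => h1.natDegree_eq_zero.1 h2, fun h => by simp [h]⟩
  rw [lCoeff, this, Finset.sum_singleton, rootSum_one, AddChar.map_zero_eq_one]

theorem lCoeff_eq_zero {F : Type*} [Field F] [Finite F] {ψ : AddChar F ℂ} (hψ : ψ ≠ 1) {g : F[X]}
    (hg : (g.natDegree : F) ≠ 0) {n : ℕ} (hn : g.natDegree ≤ n) : lCoeff ψ g n = 0 := by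
  obtain ⟨x, hx⟩ : ∃ x, ψ x ≠ 1 := by
    by_contra! h
    exact hψ (DFunLike.ext _ _ (by simpa using h))
  have hd : 0 < g.natDegree := Nat.pos_of_ne_zero fun h => hg (by simp [h])
  have hlc : g.leadingCoeff ≠ 0 := leadingCoeff_ne_zero.2 fun h => by simp [h] at hd
  set t : F := -x / (g.natDegree * g.leadingCoeff) with ht
  have htx : -(t * g.natDegree * g.leadingCoeff) = x := by
    rw [ht]; field_simp
  have hmem : ∀ s : F, ∀ h ∈ monicOfDegree F n, h + C s * X ^ (n - g.natDegree) ∈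
      monicOfDegree F n := by
    intro s h hh
    rw [mem_monicOfDegree] at hh ⊢
    have hdeg : (C s * X ^ (n - g.natDegree)).degree < h.degree := by
      refine (degree_C_mul_X_pow_le _ _).trans_lt ?_
      rw [degree_eq_natDegree hh.1.ne_zero, Nat.cast_lt, hh.2]
      omega
    exact ⟨hh.1.add_of_left hdeg, (natDegree_add_eq_left_of_degree_lt hdeg).trans hh.2⟩
  have key : lCoeff ψ g n = lCoeff ψ g n * ψ x := by
    conv_lhs => rw [lCoeff]
    rw [lCoeff, Finset.sum_mul]
    refine (Finset.sum_nbij' (fun h => h + C t * X ^ (n - g.natDegree))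
      (fun h => h + C (-t) * X ^ (n - g.natDegree)) (hmem t) (hmem (-t)) ?_ ?_ ?_).symm
    · intro h _; simp
    · intro h _; simp
    · intro h hh
      rw [mem_monicOfDegree] at hh
      have := rootSum_add_C_mul_X_pow g h hd hh.1 (hn.trans hh.2.ge) t
      rw [hh.2] at this
      rw [this, sub_eq_add_neg, htx, AddChar.map_add_eq_mul]
  have : lCoeff ψ g n * (1 - ψ x) = 0 := by linear_combination key
  exact (mul_eq_zero.1 this).resolve_right (sub_ne_zero.2 hx.symm)

theorem aeval_pow_prime_pow {p : ℕ} [Fact p.Prime] {Ω : Type*} [Field Ω] [Algebra (ZMod p) Ω]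
    (g : (ZMod p)[X]) (α : Ω) (i : ℕ) : aeval (α ^ p ^ i) g = (aeval α g) ^ p ^ i := by
  induction i with
  | zero => simp
  | succ i ih =>
    rw [pow_succ p, pow_mul, pow_mul, ← ih, ← map_pow, ← ZMod.expand_card, expand_aeval]

/-- The points of the extension of degree `j` of the prime field. -/
noncomputable def frobeniusPoints (p : ℕ) (Ω : Type*) [Field Ω] [DecidableEq Ω] (j : ℕ) :
    Finset Ω :=
  (X ^ p ^ j - X : Polynomial Ω).roots.toFinset

theorem mem_frobeniusPoints {p : ℕ} [Fact p.Prime] {Ω : Type*} [Field Ω] [DecidableEq Ω]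
    {j : ℕ} (hj : j ≠ 0) {α : Ω} : α ∈ frobeniusPoints p Ω j ↔ α ^ p ^ j = α := by
  have hp : p.Prime := Fact.out
  rw [frobeniusPoints, Multiset.mem_toFinset, mem_roots
    (FiniteField.X_pow_card_pow_sub_X_ne_zero _ hj hp.one_lt)]
  simp [sub_eq_zero]

theorem card_frobeniusPoints {p : ℕ} [Fact p.Prime] {Ω : Type*} [Field Ω] [DecidableEq Ω]
    [IsAlgClosed Ω] [CharP Ω p] {j : ℕ} (hj : j ≠ 0) : (frobeniusPoints p Ω j).card = p ^ j := by
  have hp : p.Prime := Fact.out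
  rw [frobeniusPoints, Multiset.toFinset_card_of_nodup, IsAlgClosed.card_roots_eq_natDegree,
    FiniteField.X_pow_card_pow_sub_X_natDegree_eq _ hj hp.one_lt]
  exact nodup_roots (galois_poly_separable p _ (dvd_pow_self p hj))

section Orbits

variable {p : ℕ} [Fact p.Prime] {Ω : Type*} [Field Ω] [Algebra (ZMod p) Ω]
  [Algebra.IsAlgebraic (ZMod p) Ω]

theorem natDegree_minpoly_dvd_iff {α : Ω} {j : ℕ} :
    (minpoly (ZMod p) α).natDegree ∣ j ↔ α ^ p ^ j = α := by
  have hirr := minpoly.irreducible (Algebra.IsIntegral.isIntegral (R := ZMod p) α)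
  rw [hirr.natDegree_dvd_iff_dvd_X_pow_card_pow_sub_X, minpoly.dvd_iff]
  simp [sub_eq_zero]

theorem minpoly_map_eq_prod (α : Ω) :
    (minpoly (ZMod p) α).map (algebraMap (ZMod p) Ω) =
      ∏ i ∈ Finset.range (minpoly (ZMod p) α).natDegree, (X - C (α ^ p ^ i)) := by
  have hchar : CharP Ω p := charP_of_injective_algebraMap (algebraMap (ZMod p) Ω).injective p
  have hm := minpoly.monic (Algebra.IsIntegral.isIntegral (R := ZMod p) α)
  have hinj : Set.InjOn (fun i => α ^ p ^ i)
      (Finset.range (minpoly (ZMod p) α).natDegree : Set ℕ) := by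
    have main : ∀ i k : ℕ, i + k < (minpoly (ZMod p) α).natDegree →
        α ^ p ^ i = α ^ p ^ (i + k) → k = 0 := by
      intro i k hik h
      have h1 : (α ^ p ^ k) ^ p ^ i = α ^ p ^ i := by rw [← pow_mul, ← pow_add, add_comm k, h]
      have h2 : α ^ p ^ k = α := iterateFrobenius_inj Ω p i h1
      by_contra hk
      have := Nat.le_of_dvd (Nat.pos_of_ne_zero hk) (natDegree_minpoly_dvd_iff.2 h2)
      omega
    intro i hi j hj hij
    simp only [Finset.coe_range, Set.mem_Iio] at hi hj hij
    rcases le_total i j with h | h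
    · obtain ⟨k, rfl⟩ := Nat.exists_eq_add_of_le h
      rw [main i k hj hij, add_zero]
    · obtain ⟨k, rfl⟩ := Nat.exists_eq_add_of_le h
      rw [main j k hi hij.symm, add_zero]
  refine eq_of_monic_of_dvd_of_natDegree_le (monic_prod_of_monic _ _ fun i _ => monic_X_sub_C _)
    (hm.map _) (Finset.prod_dvd_of_coprime ?_ ?_) ?_
  · intro i hi j hj hij
    exact pairwise_coprime_X_sub_C (s := fun x : Ω => x) Function.injective_id
      (fun h => hij (hinj hi hj h))
  · intro i _
    rw [dvd_iff_isRoot, IsRoot, eval_map_algebraMap, aeval_pow_prime_pow, minpoly.aeval,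
      zero_pow (pow_pos (Fact.out : p.Prime).pos i).ne']
  · rw [natDegree_map, natDegree_prod_of_monic _ _ fun i _ => monic_X_sub_C _]
    simp only [natDegree_X_sub_C]
    simp

/-- The characteristic polynomial of an element `α` of the extension of degree `j`. -/
noncomputable def orbitPoly (p : ℕ) [Fact p.Prime] {Ω : Type*} [Field Ω] [Algebra (ZMod p) Ω]
    (j : ℕ) (α : Ω) : (ZMod p)[X] :=
  minpoly (ZMod p) α ^ (j / (minpoly (ZMod p) α).natDegree)

theorem orbitPoly_monic (j : ℕ) (α : Ω) : (orbitPoly p j α).Monic :=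
  (minpoly.monic (Algebra.IsIntegral.isIntegral α)).pow _

theorem natDegree_orbitPoly {j : ℕ} {α : Ω} (hα : α ^ p ^ j = α) :
    (orbitPoly p j α).natDegree = j := by
  rw [orbitPoly, natDegree_pow, Nat.div_mul_cancel (natDegree_minpoly_dvd_iff.2 hα)]

theorem algebraMap_rootSum_orbitPoly (g : (ZMod p)[X]) {j : ℕ} {α : Ω} (hα : α ^ p ^ j = α) :
    algebraMap (ZMod p) Ω (rootSum g (orbitPoly p j α)) =
      ∑ i ∈ Finset.range j, (aeval α g) ^ p ^ i := by
  have hm := minpoly.monic (Algebra.IsIntegral.isIntegral (R := ZMod p) α)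
  obtain ⟨m, hm'⟩ := natDegree_minpoly_dvd_iff.2 hα
  set e := (minpoly (ZMod p) α).natDegree with he
  have he0 : 0 < e := minpoly.natDegree_pos (Algebra.IsIntegral.isIntegral α)
  have hαe : α ^ p ^ e = α := natDegree_minpoly_dvd_iff.1 (he ▸ dvd_rfl)
  have hper : Function.Periodic (fun i => (aeval α g) ^ p ^ i) e := by
    intro i
    simp only
    rw [← aeval_pow_prime_pow, ← aeval_pow_prime_pow, add_comm, pow_add, pow_mul, hαe]
  rw [orbitPoly, rootSum_pow g hm, map_mul, rootSum_map_prod g _ hm _ _ (minpoly_map_eq_prod α),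
    hm', ← he, Nat.mul_div_cancel_left _ he0, mul_comm e m, sum_range_mul_of_periodic _ _ hper,
    nsmul_eq_mul, map_natCast]
  simp only [aeval_pow_prime_pow]

theorem minpoly_pow_dvd_iff (α : Ω) (k : ℕ) {h : (ZMod p)[X]} (hh : h ≠ 0) :
    minpoly (ZMod p) α ^ k ∣ h ↔ k ≤ rootMultiplicity α (h.map (algebraMap (ZMod p) Ω)) := by
  have hint := Algebra.IsIntegral.isIntegral (R := ZMod p) α
  have hirr := minpoly.irreducible hint
  have hinj := (algebraMap (ZMod p) Ω).injective
  have hdvd : X - C α ∣ (minpoly (ZMod p) α).map (algebraMap (ZMod p) Ω) := by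
    rw [dvd_iff_isRoot, IsRoot, eval_map_algebraMap, minpoly.aeval]
  constructor
  · intro hk
    rw [le_rootMultiplicity_iff ((Polynomial.map_ne_zero_iff hinj).2 hh)]
    refine (pow_dvd_pow_of_dvd hdvd k).trans ?_
    rw [← Polynomial.map_pow]
    exact Polynomial.map_dvd _ hk
  · induction k generalizing h with
    | zero => simp
    | succ k ih =>
      intro hk
      have hroot : aeval α h = 0 := by
        have := (rootMultiplicity_pos ((Polynomial.map_ne_zero_iff hinj).2 hh)).1
          (Nat.lt_of_lt_of_le k.succ_pos hk)
        rwa [IsRoot, eval_map_algebraMap] at this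
      obtain ⟨h1, rfl⟩ := minpoly.dvd _ _ hroot
      rw [pow_succ']
      refine mul_dvd_mul_left _ (ih (right_ne_zero_of_mul hh) ?_)
      have hsep : ((minpoly (ZMod p) α).map (algebraMap (ZMod p) Ω)).Separable :=
        (PerfectField.separable_of_irreducible hirr).map
      have h1le := rootMultiplicity_le_one_of_separable hsep α
      rw [Polynomial.map_mul, rootMultiplicity_mul] at hk
      · omega
      · rw [← Polynomial.map_mul]
        exact (Polynomial.map_ne_zero_iff hinj).2 hh

theorem sum_card_orbitPoly_dvd [IsAlgClosed Ω] [DecidableEq Ω] {h : (ZMod p)[X]} (hh : h.Monic)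
    [∀ j, DecidablePred fun α : Ω => orbitPoly p j α ∣ h] :
    ∑ j ∈ Finset.Icc 1 h.natDegree,
      ((frobeniusPoints p Ω j).filter fun α => orbitPoly p j α ∣ h).card = h.natDegree := by
  set H := h.map (algebraMap (ZMod p) Ω) with hH
  have hH0 : H ≠ 0 := (hh.map _).ne_zero
  have hpos : ∀ α : Ω, 0 < (minpoly (ZMod p) α).natDegree := fun α =>
    minpoly.natDegree_pos (Algebra.IsIntegral.isIntegral α)
  have hdeg : h.natDegree = ∑ α ∈ H.roots.toFinset, (Finset.Icc 1 (rootMultiplicity α H)).card := by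
    simp only [Nat.card_Icc, add_tsub_cancel_right, ← count_roots]
    rw [Multiset.toFinset_sum_count_eq, IsAlgClosed.card_roots_eq_natDegree, hH, natDegree_map]
  rw [← Finset.card_sigma]
  conv_rhs => rw [hdeg]
  rw [← Finset.card_sigma]
  refine Finset.card_nbij'
    (fun x => ⟨x.2, x.1 / (minpoly (ZMod p) x.2).natDegree⟩)
    (fun y => ⟨y.2 * (minpoly (ZMod p) y.1).natDegree, y.1⟩) ?_ ?_ ?_ ?_
  · rintro ⟨j, α⟩ hx
    simp only [Finset.coe_sigma, Set.mem_sigma_iff, Finset.mem_coe, Finset.mem_Icc,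
      Finset.mem_filter] at hx ⊢
    obtain ⟨⟨h1, h2⟩, h3, h4⟩ := hx
    rw [mem_frobeniusPoints (by omega)] at h3
    have h5 := natDegree_minpoly_dvd_iff.2 h3
    have h6 := Nat.div_pos (Nat.le_of_dvd h1 h5) (hpos α)
    rw [orbitPoly, minpoly_pow_dvd_iff _ _ hh.ne_zero] at h4
    refine ⟨?_, h6, h4⟩
    rw [Multiset.mem_toFinset, mem_roots hH0, ← rootMultiplicity_pos hH0]
    exact lt_of_lt_of_le h6 h4
  · rintro ⟨α, k⟩ hx
    simp only [Finset.coe_sigma, Set.mem_sigma_iff, Finset.mem_coe, Finset.mem_Icc,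
      Finset.mem_filter] at hx ⊢
    obtain ⟨-, h1, h2⟩ := hx
    have h3 : 1 ≤ k * (minpoly (ZMod p) α).natDegree := Nat.mul_pos h1 (hpos α)
    have h4 := (minpoly_pow_dvd_iff α k hh.ne_zero).2 h2
    refine ⟨⟨h3, ?_⟩, ?_, ?_⟩
    · rw [← natDegree_pow]
      exact natDegree_le_of_dvd h4 hh.ne_zero
    · rw [mem_frobeniusPoints (by omega), ← natDegree_minpoly_dvd_iff]
      exact dvd_mul_left _ _
    · rwa [orbitPoly, Nat.mul_div_cancel _ (hpos α)]
  · rintro ⟨j, α⟩ hx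
    simp only [Finset.coe_sigma, Set.mem_sigma_iff, Finset.mem_coe, Finset.mem_Icc,
      Finset.mem_filter] at hx
    rw [mem_frobeniusPoints (by omega)] at hx
    simp only
    rw [Nat.div_mul_cancel (natDegree_minpoly_dvd_iff.2 hx.2.1)]
  · rintro ⟨α, k⟩ hx
    simp only
    rw [Nat.mul_div_cancel _ (hpos α)]

/-- The exponential sum of `g` over the extension of degree `j`. -/
noncomputable def extSum (Ω : Type*) [Field Ω] [Algebra (ZMod p) Ω] [DecidableEq Ω]
    (ψ : AddChar (ZMod p) ℂ) (g : (ZMod p)[X]) (j : ℕ) : ℂ :=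
  ∑ α ∈ frobeniusPoints p Ω j, ψ (rootSum g (orbitPoly p j α))

/-- The logarithmic derivative of the `L`-function, in terms of coefficients. -/
theorem nat_mul_lCoeff (Ω : Type*) [Field Ω] [Algebra (ZMod p) Ω]
    [Algebra.IsAlgebraic (ZMod p) Ω] [IsAlgClosed Ω] [DecidableEq Ω]
    (ψ : AddChar (ZMod p) ℂ) (g : (ZMod p)[X]) (n : ℕ) :
    n * lCoeff ψ g n = ∑ j ∈ Finset.Icc 1 n, extSum Ω ψ g j * lCoeff ψ g (n - j) := by
  classical
  have step : ∀ h ∈ monicOfDegree (ZMod p) n, (n : ℂ) * ψ (rootSum g h) =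
      ∑ j ∈ Finset.Icc 1 n, ∑ α ∈ frobeniusPoints p Ω j,
        if orbitPoly p j α ∣ h then ψ (rootSum g h) else 0 := by
    intro h hh
    rw [mem_monicOfDegree] at hh
    have := sum_card_orbitPoly_dvd (Ω := Ω) hh.1
    rw [hh.2] at this
    conv_lhs => rw [← this]
    push_cast
    rw [Finset.sum_mul]
    refine Finset.sum_congr rfl fun j _ => ?_
    rw [← Finset.sum_filter, Finset.sum_const, nsmul_eq_mul]
  rw [lCoeff, Finset.mul_sum, Finset.sum_congr rfl step, Finset.sum_comm]
  refine Finset.sum_congr rfl fun j hj => ?_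
  rw [Finset.mem_Icc] at hj
  rw [Finset.sum_comm, extSum, Finset.sum_mul]
  refine Finset.sum_congr rfl fun α hα => ?_
  rw [mem_frobeniusPoints (by omega)] at hα
  have hm := orbitPoly_monic (p := p) j α
  have hd := natDegree_orbitPoly hα
  rw [← Finset.sum_filter, lCoeff, Finset.mul_sum]
  symm
  refine Finset.sum_bij (fun k _ => orbitPoly p j α * k) ?_ ?_ ?_ ?_
  · intro k hk
    rw [mem_monicOfDegree] at hk
    rw [Finset.mem_filter, mem_monicOfDegree]
    refine ⟨⟨hm.mul hk.1, ?_⟩, dvd_mul_right _ _⟩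
    rw [hm.natDegree_mul hk.1, hd, hk.2]
    omega
  · intro k _ k' _ h
    exact mul_left_cancel₀ hm.ne_zero h
  · intro h hh
    rw [Finset.mem_filter, mem_monicOfDegree] at hh
    obtain ⟨⟨h1, h2⟩, k, rfl⟩ := hh
    have hk : k.Monic := hm.of_mul_monic_left h1
    refine ⟨k, ?_, rfl⟩
    rw [mem_monicOfDegree]
    rw [hm.natDegree_mul hk, hd] at h2
    exact ⟨hk, by omega⟩
  · intro k hk
    rw [mem_monicOfDegree] at hk
    rw [rootSum_mul g hm hk.1, AddChar.map_add_eq_mul]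

end Orbits

theorem mk_pow_mul_one_sub (w : ℂ) :
    PowerSeries.mk (fun n => if n = 0 then 0 else w ^ n) * ((1 - C w * X : ℂ[X]) : PowerSeries ℂ) =
      PowerSeries.C w * PowerSeries.X := by
  rw [coe_sub, coe_one, coe_mul, coe_C, coe_X]
  ext n
  rw [mul_sub, mul_one, mul_comm (PowerSeries.C w), ← mul_assoc, map_sub]
  rcases n with _ | _ | n
  · simp
  · rw [PowerSeries.coeff_mul_C, PowerSeries.coeff_succ_mul_X, PowerSeries.coeff_succ_X_mul]
    simp
  · rw [PowerSeries.coeff_mul_C, PowerSeries.coeff_succ_mul_X, PowerSeries.coeff_succ_X_mul]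
    simp [pow_succ]

theorem X_mul_derivative_prod_one_sub (s : Multiset ℂ) :
    PowerSeries.X * ((derivative (s.map fun w => 1 - C w * X).prod : ℂ[X]) : PowerSeries ℂ) =
      -PowerSeries.mk (fun n => if n = 0 then 0 else (s.map fun w => w ^ n).sum) *
        (((s.map fun w => 1 - C w * X).prod : ℂ[X]) : PowerSeries ℂ) := by
  induction s using Multiset.induction_on with
  | empty =>
    have : PowerSeries.mk (fun n => if n = 0 then 0 else
      ((0 : Multiset ℂ).map fun w => w ^ n).sum) = 0 := by
      ext n; simp
    rw [this]; simp
  | cons w s ih =>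
    have hadd : PowerSeries.mk (fun n => if n = 0 then 0 else
        ((w ::ₘ s).map fun w => w ^ n).sum) =
        PowerSeries.mk (fun n => if n = 0 then 0 else w ^ n) +
        PowerSeries.mk (fun n => if n = 0 then 0 else (s.map fun w => w ^ n).sum) := by
      ext n
      by_cases hn : n = 0 <;> simp [hn]
    have hd : derivative (1 - C w * X : ℂ[X]) = -C w := by simp
    have h1 := mk_pow_mul_one_sub w
    rw [hadd, Multiset.map_cons, Multiset.prod_cons, derivative_mul, hd]
    rw [coe_add, coe_mul, coe_mul, coe_mul, coe_neg, coe_C]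
    linear_combination ((1 - C w * X : ℂ[X]) : PowerSeries ℂ) * ih +
      (((s.map fun w => 1 - C w * X).prod : ℂ[X]) : PowerSeries ℂ) * h1

theorem exists_eq_prod_one_sub {P : ℂ[X]} (hP : P.coeff 0 = 1) :
    ∃ s : Multiset ℂ, s.card ≤ P.natDegree ∧ P = (s.map fun w => 1 - C w * X).prod := by
  have hP0 : P ≠ 0 := by rintro rfl; simp at hP
  refine ⟨P.roots.map (·⁻¹), by rw [Multiset.card_map]; exact card_roots' P, ?_⟩
  have hr : ∀ r ∈ P.roots, r ≠ 0 := by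
    rintro r hr rfl
    rw [mem_roots hP0, IsRoot, ← coeff_zero_eq_eval_zero, hP] at hr
    exact one_ne_zero hr
  have h1 := (IsAlgClosed.splits P).eq_prod_roots
  have h2 : (P.roots.map fun r => X - C r).prod =
      (P.roots.map fun r => C (-r)).prod * (P.roots.map fun r => 1 - C r⁻¹ * X).prod := by
    rw [← Multiset.prod_map_mul]
    congr 1
    refine Multiset.map_congr rfl fun r hr' => ?_
    have : C r * C r⁻¹ = (1 : ℂ[X]) := by rw [← C_mul, mul_inv_cancel₀ (hr r hr'), C_1]
    rw [C_neg]
    linear_combination (-X : ℂ[X]) * this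
  have h3 : (P.roots.map fun r => C (-r)).prod = C (P.roots.map fun r => -r).prod := by
    rw [map_multiset_prod, Multiset.map_map]; rfl
  rw [Multiset.map_map]
  rw [h2, h3, ← mul_assoc, ← C_mul] at h1
  set k := P.leadingCoeff * (P.roots.map fun r => -r).prod with hk
  have hk1 : k = 1 := by
    have := congrArg (eval 0) h1
    rw [← coeff_zero_eq_eval_zero, hP, eval_mul, eval_C, eval_multiset_prod, Multiset.map_map] at this
    simpa using this.symm
  rw [hk1, C_1, one_mul] at h1
  exact h1

/-- A sequence satisfying Newton's identities for the polynomial `P` consists of (negated) power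
sums. -/
theorem exists_power_sums {P : ℂ[X]} (hP : P.coeff 0 = 1) (S : ℕ → ℂ)
    (hS : ∀ n : ℕ, n * P.coeff n = ∑ j ∈ Finset.Icc 1 n, S j * P.coeff (n - j)) :
    ∃ s : Multiset ℂ, s.card ≤ P.natDegree ∧ ∀ n ≠ 0, S n = -(s.map fun w => w ^ n).sum := by
  obtain ⟨s, hs, hPs⟩ := exists_eq_prod_one_sub hP
  refine ⟨s, hs, fun n hn => ?_⟩
  have hP0 : (P : PowerSeries ℂ) ≠ 0 := by
    intro h
    have := congrArg PowerSeries.constantCoeff h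
    simp [hP] at this
  have h1 := X_mul_derivative_prod_one_sub s
  rw [← hPs] at h1
  have h2 : PowerSeries.X * ((derivative P : ℂ[X]) : PowerSeries ℂ) =
      PowerSeries.mk (fun n => if n = 0 then 0 else S n) * (P : PowerSeries ℂ) := by
    ext n
    rw [PowerSeries.coeff_mul _ (PowerSeries.mk _), Finset.Nat.sum_antidiagonal_eq_sum_range_succ
      (fun i j => PowerSeries.coeff i (PowerSeries.mk fun n => if n = 0 then 0 else S n) *
        PowerSeries.coeff j (P : PowerSeries ℂ))]
    have h3 : ∑ j ∈ Finset.Icc 1 n, S j * P.coeff (n - j) =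
        ∑ j ∈ Finset.range n, S (j + 1) * P.coeff (n - (j + 1)) := by
      rw [Finset.range_eq_Ico, Finset.sum_Ico_add' (fun j => S j * P.coeff (n - j)) 0 n 1]
      rfl
    rw [Finset.sum_range_succ']
    simp only [PowerSeries.coeff_mk, Polynomial.coeff_coe, Nat.add_eq_zero_iff, one_ne_zero,
      and_false, if_false, if_true, zero_mul, add_zero]
    rw [← h3, ← hS]
    rcases n with _ | n
    · simp
    · rw [PowerSeries.coeff_succ_X_mul, Polynomial.coeff_coe, coeff_derivative]
      push_cast; ring
  have h3 := mul_right_cancel₀ hP0 (h2.symm.trans h1)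
  have := congrArg (PowerSeries.coeff n) h3
  simpa [hn] using this

theorem norm_le_one_of_power_sums_bounded {ι : Type*} (s : Finset ι) (z : ι → ℂ) (c : ι → ℝ)
    (hc : ∀ i ∈ s, 0 < c i) (B : ℝ) (hB : ∀ b : ℕ, ‖∑ i ∈ s, c i * z i ^ (b + 1)‖ ≤ B) :
    ∀ i ∈ s, ‖z i‖ ≤ 1 := by
  classical
  intro i hi
  obtain ⟨i₀, hi₀, hmax⟩ := s.exists_max_image (fun i => ‖z i‖) ⟨i, hi⟩
  refine (hmax i hi).trans ?_
  by_contra! hρ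
  set ρ := ‖z i₀‖ with hρdef
  have hρ0 : 0 < ρ := one_pos.trans hρ
  have hz0 : z i₀ ≠ 0 := norm_pos_iff.1 hρ0
  set u : ι → ℂ := fun i => z i / z i₀ with hu
  have hu1 : ∀ i ∈ s, ‖u i‖ ≤ 1 := by
    intro i hi
    rw [hu]
    simp only [norm_div]
    exact (div_le_one hρ0).2 (hmax i hi)
  have hB0 : 0 ≤ B := (norm_nonneg _).trans (hB 0)
  have hgeom : ∀ N : ℕ, ∑ b ∈ Finset.range N, (ρ⁻¹) ^ b ≤ (1 - ρ⁻¹)⁻¹ := fun N => by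
    simpa using geom_sum_Ico_le_of_lt_one (m := 0) (n := N) (inv_nonneg.2 hρ0.le)
      (inv_lt_one_of_one_lt₀ hρ)
  have hA : ∀ N : ℕ, ‖∑ b ∈ Finset.range N, ∑ i ∈ s, c i * u i ^ (b + 1)‖ ≤
      B * (1 - ρ⁻¹)⁻¹ := by
    intro N
    refine (norm_sum_le _ _).trans ((Finset.sum_le_sum fun b _ => ?_).trans
      ((Finset.mul_sum _ _ _).symm.trans_le (mul_le_mul_of_nonneg_left (hgeom N) hB0)))
    have h1 : ∑ i ∈ s, c i * u i ^ (b + 1) = (∑ i ∈ s, c i * z i ^ (b + 1)) / z i₀ ^ (b + 1) := by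
      rw [Finset.sum_div]
      exact Finset.sum_congr rfl fun i _ => by rw [hu]; simp only [div_pow]; ring
    rw [h1, norm_div, norm_pow, ← hρdef, div_eq_mul_inv, ← inv_pow]
    refine mul_le_mul (hB b) ?_ (by positivity) hB0
    exact pow_le_pow_of_le_one (inv_nonneg.2 hρ0.le) (inv_lt_one_of_one_lt₀ hρ).le b.le_succ
  have hother : ∀ N : ℕ, ‖∑ i ∈ s with u i ≠ 1, (c i : ℂ) * ∑ b ∈ Finset.range N, u i ^ (b + 1)‖ ≤
      ∑ i ∈ s with u i ≠ 1, c i * (2 / ‖u i - 1‖) := by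
    intro N
    refine norm_sum_le_of_le _ fun i hi => ?_
    rw [Finset.mem_filter] at hi
    have hci := (hc i hi.1).le
    rw [norm_mul, Complex.norm_real, Real.norm_of_nonneg hci]
    refine mul_le_mul_of_nonneg_left ?_ hci
    simp only [pow_succ]
    rw [← Finset.sum_mul, geom_sum_eq hi.2, norm_mul, norm_div]
    have h2 : ‖u i ^ N - 1‖ ≤ 2 := by
      refine (norm_sub_le _ _).trans ?_
      rw [norm_pow, norm_one]
      have := pow_le_one₀ (n := N) (norm_nonneg _) (hu1 i hi.1)
      linarith
    refine (mul_le_of_le_one_right (by positivity) (hu1 i hi.1)).trans ?_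
    gcongr
  set K := B * (1 - ρ⁻¹)⁻¹ + ∑ i ∈ s with u i ≠ 1, c i * (2 / ‖u i - 1‖) with hK
  have hN : ∀ N : ℕ, N * c i₀ ≤ K := by
    intro N
    have hsplit : ∑ b ∈ Finset.range N, ∑ i ∈ s, (c i : ℂ) * u i ^ (b + 1) =
        ((∑ i ∈ s with u i = 1, N * c i : ℝ) : ℂ) +
          ∑ i ∈ s with u i ≠ 1, (c i : ℂ) * ∑ b ∈ Finset.range N, u i ^ (b + 1) := by
      rw [Finset.sum_comm, ← Finset.sum_filter_add_sum_filter_not s (fun i => u i = 1)]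
      congr 1
      · push_cast
        refine Finset.sum_congr rfl fun i hi => ?_
        rw [(Finset.mem_filter.1 hi).2]
        simp
      · exact Finset.sum_congr rfl fun i _ => (Finset.mul_sum _ _ _).symm
    have h1 : N * c i₀ ≤ ∑ i ∈ s with u i = 1, N * c i :=
      Finset.single_le_sum (f := fun i => (N : ℝ) * c i)
        (fun i hi => mul_nonneg N.cast_nonneg (hc i (Finset.mem_filter.1 hi).1).le)
        (Finset.mem_filter.2 ⟨hi₀, div_self hz0⟩)
    have h2 : ∑ i ∈ s with u i = 1, N * c i ≤ K := by
      refine (le_abs_self _).trans ?_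
      rw [← Real.norm_eq_abs, ← Complex.norm_real, eq_sub_of_add_eq hsplit.symm]
      exact (norm_sub_le _ _).trans (add_le_add (hA N) (hother N))
    exact h1.trans h2
  obtain ⟨N, hN'⟩ := exists_nat_gt (K / c i₀)
  rw [div_lt_iff₀ (hc i₀ hi₀)] at hN'
  exact absurd (hN N) (not_le.2 hN')

theorem norm_extSum_even_le {p : ℕ} [Fact p.Prime] (Ω : Type*) [Field Ω] [Algebra (ZMod p) Ω]
    [Algebra.IsAlgebraic (ZMod p) Ω] [IsAlgClosed Ω] [DecidableEq Ω]
    {ψ : AddChar (ZMod p) ℂ} (hψ : ψ ≠ 1) (g : (ZMod p)[X]) (hg : ¬ p ∣ g.natDegree) (b : ℕ) :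
    ‖extSum Ω ψ g (2 * (b + 1))‖ ≤ 2 * p * (3 * g.natDegree + 5) * (p : ℝ) ^ (b + 1) := by
  classical
  have hchar : CharP Ω p := charP_of_injective_algebraMap (algebraMap (ZMod p) Ω).injective p
  set j := 2 * (b + 1) with hj
  have hj0 : j ≠ 0 := by omega
  set T := frobeniusPoints p Ω j with hT
  set N : ZMod p → ℕ := fun c => (T.filter fun α => rootSum g (orbitPoly p j α) = c).card with hN
  set M : ℝ := (p : ℝ) ^ (2 * b + 1) with hM
  set K : ℝ := (3 * g.natDegree + 5) * (p : ℝ) ^ (b + 1) with hK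
  have hle : ∀ c, (N c : ℝ) ≤ M + K := by
    intro c
    have := card_trace_eq_le g hg b c (T.filter fun α => rootSum g (orbitPoly p j α) = c) (by
      intro α hα
      rw [Finset.mem_filter, hT, mem_frobeniusPoints hj0] at hα
      exact ⟨hα.1, by rw [← hα.2, algebraMap_rootSum_orbitPoly g hα.1]⟩)
    rw [hM, hK]
    exact_mod_cast this
  have hcard : ∑ c, (N c : ℝ) = p * M := by
    have h1 : T.card = ∑ c, N c :=
      Finset.card_eq_sum_card_fiberwise (f := fun α => rootSum g (orbitPoly p j α))
        (fun _ _ => Finset.mem_coe.2 (Finset.mem_univ _))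
    have h2 : T.card = p ^ j := card_frobeniusPoints hj0
    rw [← Nat.cast_sum, ← h1, h2, hM, hj]
    push_cast; ring
  have hsum : extSum Ω ψ g j = ∑ c, ψ c * (N c : ℂ) := by
    rw [extSum, ← Finset.sum_fiberwise T (fun α => rootSum g (orbitPoly p j α))]
    refine Finset.sum_congr rfl fun c _ => ?_
    rw [Finset.sum_congr rfl (fun α hα => by rw [(Finset.mem_filter.1 hα).2]),
      Finset.sum_const, nsmul_eq_mul, mul_comm]
  have hψ0 : ∑ c, ψ c = 0 := AddChar.sum_eq_zero_of_ne_one hψ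
  have hsum' : extSum Ω ψ g j = ∑ c, ψ c * ((N c - M : ℝ) : ℂ) := by
    rw [hsum]
    push_cast
    simp only [mul_sub, Finset.sum_sub_distrib, ← Finset.sum_mul, hψ0]
    simp
  rw [hsum']
  have hK0 : 0 ≤ K := by rw [hK]; positivity
  calc ‖∑ c, ψ c * ((N c - M : ℝ) : ℂ)‖ ≤ ∑ c, (2 * K - (N c - M)) := by
        refine norm_sum_le_of_le _ fun c _ => ?_
        rw [norm_mul, AddChar.norm_apply, one_mul, Complex.norm_real, Real.norm_eq_abs, abs_le]
        have := hle c
        constructor <;> linarith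
    _ = 2 * p * (3 * g.natDegree + 5) * (p : ℝ) ^ (b + 1) := by
        rw [Finset.sum_sub_distrib, Finset.sum_sub_distrib, hcard]
        simp only [Finset.sum_const, Finset.card_univ, ZMod.card, nsmul_eq_mul]
        rw [hK]; ring

theorem extSum_one {p : ℕ} [Fact p.Prime] (Ω : Type*) [Field Ω] [Algebra (ZMod p) Ω]
    [Algebra.IsAlgebraic (ZMod p) Ω] [IsAlgClosed Ω] [DecidableEq Ω]
    (ψ : AddChar (ZMod p) ℂ) (g : (ZMod p)[X]) :
    extSum Ω ψ g 1 = ∑ x : ZMod p, ψ (g.eval x) := by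
  have hchar : CharP Ω p := charP_of_injective_algebraMap (algebraMap (ZMod p) Ω).injective p
  have hinj := (algebraMap (ZMod p) Ω).injective
  have hmem : ∀ x : ZMod p, (algebraMap (ZMod p) Ω x) ^ p ^ 1 = algebraMap (ZMod p) Ω x := by
    intro x
    rw [pow_one, ← map_pow, ZMod.pow_card]
  have himg : frobeniusPoints p Ω 1 = Finset.univ.image (algebraMap (ZMod p) Ω) := by
    symm
    refine Finset.eq_of_subset_of_card_le ?_ ?_
    · intro α hα
      obtain ⟨x, -, rfl⟩ := Finset.mem_image.1 hα
      exact (mem_frobeniusPoints one_ne_zero).2 (hmem x)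
    · rw [card_frobeniusPoints one_ne_zero, Finset.card_image_of_injective _ hinj,
        Finset.card_univ, ZMod.card, pow_one]
  rw [extSum, himg, Finset.sum_image fun x _ y _ h => hinj h]
  refine Finset.sum_congr rfl fun x _ => ?_
  congr 1
  apply hinj
  rw [algebraMap_rootSum_orbitPoly g (hmem x)]
  simp [aeval_algebraMap_apply]

/-- Weil's bound for additive character sums of a polynomial over a prime field. -/
theorem weil_bound {p : ℕ} [Fact p.Prime] {ψ : AddChar (ZMod p) ℂ} (hψ : ψ ≠ 1)
    (g : (ZMod p)[X]) (hg : ¬ p ∣ g.natDegree) :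
    ‖∑ x : ZMod p, ψ (g.eval x)‖ ≤ g.natDegree * √p := by
  classical
  set Ω := AlgebraicClosure (ZMod p)
  have hp : (0 : ℝ) < p := Nat.cast_pos.2 (Fact.out : p.Prime).pos
  have hd : 0 < g.natDegree := Nat.pos_of_ne_zero fun h => hg (h ▸ dvd_zero p)
  set P : ℂ[X] := ∑ n ∈ Finset.range g.natDegree, C (lCoeff ψ g n) * X ^ n with hP
  have hPc : ∀ n, P.coeff n = lCoeff ψ g n := by
    intro n
    rw [hP, finsetSum_coeff]
    simp only [coeff_C_mul_X_pow, Finset.sum_ite_eq, Finset.mem_range]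
    split_ifs with h
    · rfl
    · rw [lCoeff_eq_zero hψ ((ZMod.natCast_eq_zero_iff _ _).not.2 hg) (not_lt.1 h)]
  obtain ⟨s, hs, hS⟩ := exists_power_sums (P := P) (by rw [hPc, lCoeff_zero]) (extSum Ω ψ g)
    (by simpa only [hPc] using nat_mul_lCoeff Ω ψ g)
  have hPd : P.natDegree ≤ g.natDegree := by
    refine natDegree_sum_le_of_forall_le _ _ fun n hn => ?_
    exact (natDegree_C_mul_X_pow_le _ _).trans (Finset.mem_range.1 hn).le
  have hsmall : ∀ w ∈ s.toFinset, ‖w ^ 2 / p‖ ≤ 1 := by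
    refine norm_le_one_of_power_sums_bounded s.toFinset (fun w => w ^ 2 / p)
      (fun w => s.count w) (fun w hw => ?_) (2 * p * (3 * g.natDegree + 5)) fun b => ?_
    · exact Nat.cast_pos.2 (Multiset.count_pos.2 (Multiset.mem_toFinset.1 hw))
    · have h1 : ∑ w ∈ s.toFinset, (((s.count w : ℕ) : ℝ) : ℂ) * (w ^ 2 / p) ^ (b + 1) =
          -(extSum Ω ψ g (2 * (b + 1))) / (p : ℂ) ^ (b + 1) := by
        rw [hS _ (by omega), neg_neg, Finset.sum_multiset_map_count, Finset.sum_div]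
        refine Finset.sum_congr rfl fun w _ => ?_
        rw [div_pow, ← pow_mul, nsmul_eq_mul]
        push_cast; ring
      rw [h1, norm_div, norm_neg, norm_pow, Complex.norm_natCast, div_le_iff₀ (by positivity)]
      exact norm_extSum_even_le Ω hψ g hg b
  have hw : ∀ w ∈ s, ‖w‖ ≤ √p := by
    intro w hw
    have := hsmall w (Multiset.mem_toFinset.2 hw)
    rw [norm_div, norm_pow, Complex.norm_natCast, div_le_one hp] at this
    exact Real.le_sqrt_of_sq_le this
  rw [← extSum_one Ω, hS 1 one_ne_zero, norm_neg]
  simp only [pow_one, Multiset.map_id']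
  rw [Finset.sum_multiset_count]
  calc ‖∑ w ∈ s.toFinset, s.count w • w‖ ≤ ∑ w ∈ s.toFinset, s.count w * √p := by
        refine norm_sum_le_of_le _ fun w hw' => ?_
        rw [nsmul_eq_mul, norm_mul, Complex.norm_natCast]
        exact mul_le_mul_of_nonneg_left (hw w (Multiset.mem_toFinset.1 hw')) (Nat.cast_nonneg _)
    _ = s.card * √p := by
        rw [← Finset.sum_mul, ← Nat.cast_sum, Multiset.toFinset_sum_count_eq]
    _ ≤ g.natDegree * √p := by
        gcongr
        exact hs.trans hPd

/-- The additive character `x ↦ e^{2πi x/p^n}` of `ℤ`. -/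
noncomputable def expChar (p n : ℕ) (x : ℤ) : ℂ :=
  Complex.exp (2 * (Real.pi : ℂ) * Complex.I * (x : ℂ) / (p : ℂ) ^ n)

theorem expSum_eq (p n : ℕ) (f : ℤ[X]) :
    expSum p n f = ((p : ℂ) ^ n)⁻¹ * ∑ x ∈ Finset.range (p ^ n), expChar p n (f.eval (x : ℤ)) :=
  rfl

theorem expChar_add (p n : ℕ) (x y : ℤ) : expChar p n (x + y) = expChar p n x * expChar p n y := by
  rw [expChar, expChar, expChar, ← Complex.exp_add]
  push_cast
  ring_nf

theorem norm_expChar (p n : ℕ) (x : ℤ) : ‖expChar p n x‖ = 1 := by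
  have : 2 * (Real.pi : ℂ) * Complex.I * (x : ℂ) / (p : ℂ) ^ n =
      ((2 * Real.pi * x / (p : ℝ) ^ n : ℝ) : ℂ) * Complex.I := by
    push_cast; ring
  rw [expChar, this, Complex.norm_exp_ofReal_mul_I]

theorem expChar_succ_mul {p : ℕ} (hp : p ≠ 0) (n : ℕ) (x : ℤ) :
    expChar p (n + 1) (p * x) = expChar p n x := by
  have : (p : ℂ) ≠ 0 := Nat.cast_ne_zero.2 hp
  rw [expChar, expChar]
  congr 1
  push_cast
  field_simp
  ring

theorem expChar_eq_one {p : ℕ} (hp : p ≠ 0) (n : ℕ) (x : ℤ) :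
    expChar p n x = 1 ↔ (p : ℤ) ^ n ∣ x := by
  have h0 : (p : ℂ) ≠ 0 := Nat.cast_ne_zero.2 hp
  have h1 := Complex.two_pi_I_ne_zero
  rw [expChar, Complex.exp_eq_one_iff]
  refine exists_congr fun k => ?_
  rw [mul_div_assoc, mul_comm (k : ℂ), mul_right_inj' h1, div_eq_iff (pow_ne_zero _ h0)]
  constructor
  · intro h
    rw [mul_comm]
    exact_mod_cast h
  · rintro rfl
    push_cast
    ring

theorem expChar_congr {p : ℕ} (hp : p ≠ 0) (n : ℕ) {x y : ℤ} (h : (p : ℤ) ^ n ∣ x - y) :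
    expChar p n x = expChar p n y := by
  rw [← sub_add_cancel x y, expChar_add, (expChar_eq_one hp n _).2 h, one_mul]

theorem norm_expSum_le_one {p : ℕ} (hp : p ≠ 0) (n : ℕ) (f : ℤ[X]) : ‖expSum p n f‖ ≤ 1 := by
  rw [expSum_eq, norm_mul, norm_inv, norm_pow, Complex.norm_natCast]
  have hp' : (0 : ℝ) < (p : ℝ) ^ n := by positivity
  rw [inv_mul_le_iff₀ hp', mul_one]
  refine (norm_sum_le _ _).trans ?_
  simp [norm_expChar]

theorem expChar_eval_periodic {p : ℕ} (hp : p ≠ 0) (n : ℕ) (f : ℤ[X]) :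
    Function.Periodic (fun x : ℕ => expChar p n (f.eval (x : ℤ))) (p ^ n) := by
  intro x
  refine expChar_congr hp n ?_
  have := f.sub_dvd_eval_sub ((x : ℤ) + (p : ℤ) ^ n) x
  rw [add_sub_cancel_left] at this
  exact_mod_cast this

theorem sum_range_add_of_periodic {M : Type*} [AddCommGroup M] {φ : ℕ → M} {N : ℕ}
    (hφ : Function.Periodic φ N) (a : ℕ) :
    ∑ x ∈ Finset.range N, φ (x + a) = ∑ x ∈ Finset.range N, φ x := by
  induction a with
  | zero => rfl
  | succ a ih =>
    have h1 := Finset.sum_range_succ' (fun x => φ (x + a)) N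
    rw [Finset.sum_range_succ, ih, zero_add, add_comm N a, hφ a] at h1
    rw [add_right_cancel h1]
    exact Finset.sum_congr rfl fun x _ => by ring_nf

theorem sum_range_mul_eq {M : Type*} [AddCommMonoid M] (φ : ℕ → M) (a b : ℕ) :
    ∑ x ∈ Finset.range (a * b), φ x =
      ∑ u ∈ Finset.range a, ∑ t ∈ Finset.range b, φ (u + a * t) := by
  rw [Finset.sum_comm]
  induction b with
  | zero => simp
  | succ b ih =>
    rw [Nat.mul_succ, Finset.sum_range_add, ih, Finset.sum_range_succ]
    simp only [add_comm]

theorem expSum_C_add_C_mul {p : ℕ} (hp : p ≠ 0) (n : ℕ) (c : ℤ) (h : ℤ[X]) :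
    expSum p (n + 1) (C c + C (p : ℤ) * h) = expChar p (n + 1) c * expSum p n h := by
  have hp' : (p : ℂ) ≠ 0 := Nat.cast_ne_zero.2 hp
  rw [expSum_eq, expSum_eq]
  simp only [eval_add, eval_mul, eval_C, expChar_add, expChar_succ_mul hp]
  rw [← Finset.mul_sum, pow_succ' p, sum_range_mul_of_periodic _ _ (expChar_eval_periodic hp n h),
    nsmul_eq_mul]
  field_simp
  ring

theorem norm_expSum_C_add_C_mul {p : ℕ} (hp : p ≠ 0) (n : ℕ) (c : ℤ) (h : ℤ[X]) :
    ‖expSum p (n + 1) (C c + C (p : ℤ) * h)‖ = ‖expSum p n h‖ := by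
  rw [expSum_C_add_C_mul hp, norm_mul, norm_expChar, one_mul]

theorem norm_expSum_succ_le {p : ℕ} (hp : p ≠ 0) (n : ℕ) (g : ℤ[X]) (c : ℕ → ℤ) (h : ℕ → ℤ[X])
    (hg : ∀ u : ℕ, g.comp (C (u : ℤ) + C (p : ℤ) * X) = C (c u) + C (p : ℤ) * h u) :
    ‖expSum p (n + 1) g‖ ≤ (p : ℝ)⁻¹ * ∑ u ∈ Finset.range p, ‖expSum p n (h u)‖ := by
  have key : expSum p (n + 1) g =
      (p : ℂ)⁻¹ * ∑ u ∈ Finset.range p, expChar p (n + 1) (c u) * expSum p n (h u) := by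
    rw [expSum_eq, pow_succ' p, sum_range_mul_eq, pow_succ', mul_inv, mul_assoc, Finset.mul_sum]
    congr 1
    refine Finset.sum_congr rfl fun u _ => ?_
    rw [expSum_eq, mul_left_comm, Finset.mul_sum, Finset.mul_sum, Finset.mul_sum]
    refine Finset.sum_congr rfl fun t _ => ?_
    have := congrArg (eval (t : ℤ)) (hg u)
    simp only [eval_comp, eval_add, eval_mul, eval_C, eval_X] at this
    push_cast
    rw [this, expChar_add, expChar_succ_mul hp]
  rw [key, norm_mul, norm_inv, Complex.norm_natCast]
  gcongr
  refine norm_sum_le_of_le _ fun u _ => ?_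
  rw [norm_mul, norm_expChar, one_mul]

theorem expSum_C_mul_X_add_eq_zero {p : ℕ} (hp : p ≠ 0) (n : ℕ) {c : ℤ} (hc : ¬ (p : ℤ) ∣ c)
    (r : ℤ[X]) : expSum p (n + 1) (C c * X + C (p : ℤ) * r) = 0 := by
  set h := C c * X + C (p : ℤ) * r with hh
  have hp' : (p : ℤ) ≠ 0 := Nat.cast_ne_zero.2 hp
  have h1 : ∀ t : ℕ, expChar p (n + 1) (h.eval ((t + p ^ n : ℕ) : ℤ)) =
      expChar p (n + 1) (c * p ^ n) * expChar p (n + 1) (h.eval (t : ℤ)) := by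
    intro t
    rw [← expChar_add]
    refine expChar_congr hp _ ?_
    obtain ⟨k, hk⟩ := r.sub_dvd_eval_sub ((t : ℤ) + (p : ℤ) ^ n) t
    refine ⟨k, ?_⟩
    rw [add_sub_cancel_left] at hk
    simp only [hh, eval_add, eval_mul, eval_C, eval_X]
    push_cast
    linear_combination (p : ℤ) * hk
  have h2 := sum_range_add_of_periodic (expChar_eval_periodic hp (n + 1) h) (p ^ n)
  simp only [h1] at h2
  rw [← Finset.mul_sum] at h2
  have h3 : expChar p (n + 1) (c * p ^ n) ≠ 1 := by
    rw [Ne, expChar_eq_one hp, pow_succ', mul_dvd_mul_iff_right (pow_ne_zero _ hp')]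
    exact hc
  have h4 : (expChar p (n + 1) (c * p ^ n) - 1) *
      ∑ x ∈ Finset.range (p ^ (n + 1)), expChar p (n + 1) (h.eval (x : ℤ)) = 0 := by
    rw [sub_mul, h2, one_mul, sub_self]
  rw [expSum_eq, (mul_eq_zero.1 h4).resolve_left (sub_ne_zero.2 h3), mul_zero]

theorem exists_comp_eq (p : ℕ) (g : ℤ[X]) (u : ℤ) : ∃ r : ℤ[X],
    g.comp (C u + C (p : ℤ) * X) =
      C (g.eval u) + C (p : ℤ) * (C ((derivative g).eval u) * X + C (p : ℤ) * r) := by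
  obtain ⟨k, hk⟩ := (g.map C).binomExpansion (C u) (C (p : ℤ) * X)
  refine ⟨k * X ^ 2, ?_⟩
  rw [derivative_map, eval_map, eval_map, eval_map, eval₂_at_apply, eval₂_at_apply] at hk
  rw [comp, hk]
  ring

theorem exists_eq_C_add_C_mul {p : ℕ} (hp : p.Prime) {g : ℤ[X]} (hg : g.natDegree < p)
    (h : ∀ i, (p : ℤ) ∣ (derivative g).coeff i) : ∃ h : ℤ[X], g = C (g.coeff 0) + C (p : ℤ) * h := by
  have h1 : C (p : ℤ) ∣ g - C (g.coeff 0) := by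
    rw [C_dvd_iff_dvd_coeff]
    rintro (_ | i)
    · simp
    · rw [coeff_sub, coeff_C_succ, sub_zero]
      by_cases hi : g.natDegree < i + 1
      · rw [coeff_eq_zero_of_natDegree_lt hi]; exact dvd_zero _
      have h2 := h i
      rw [coeff_derivative] at h2
      refine ((Nat.prime_iff_prime_int.1 hp).dvd_or_dvd h2).resolve_right fun h3 => ?_
      have h4 : p ∣ i + 1 := by exact_mod_cast h3
      have := Nat.le_of_dvd i.succ_pos h4
      omega
  obtain ⟨h, hh⟩ := h1
  exact ⟨h, by rw [← hh]; ring⟩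

theorem norm_expSum_one_le {p : ℕ} [Fact p.Prime] {g : ℤ[X]} (hg : g.natDegree < p)
    (h : ¬ ∀ i, (p : ℤ) ∣ (derivative g).coeff i) :
    ‖expSum p 1 g‖ ≤ g.natDegree * √(p : ℝ)⁻¹ := by
  have hp := (Fact.out : p.Prime)
  set G := g.map (Int.castRingHom (ZMod p)) with hG
  have hdeg : G.natDegree ≤ g.natDegree := natDegree_map_le
  have hG0 : ¬ p ∣ G.natDegree := by
    intro hdvd
    have h0 : G.natDegree = 0 := Nat.eq_zero_of_dvd_of_lt hdvd (hdeg.trans_lt hg)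
    refine h fun i => ?_
    have h1 : derivative G = 0 := derivative_of_natDegree_zero h0
    rw [hG, derivative_map] at h1
    have := congrArg (fun q => q.coeff i) h1
    rwa [coeff_map, coeff_zero, eq_intCast, ZMod.intCast_zmod_eq_zero_iff_dvd] at this
  have hψ : (ZMod.stdAddChar : AddChar (ZMod p) ℂ) ≠ 1 := by
    have := ZMod.isPrimitive_stdAddChar p one_ne_zero
    simpa [AddChar.mulShift_one] using this
  have hsum : ∑ x ∈ Finset.range (p ^ 1), expChar p 1 (g.eval (x : ℤ)) =
      ∑ x : ZMod p, ZMod.stdAddChar (G.eval x) := by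
    rw [pow_one]
    refine Finset.sum_bij' (fun x _ => (x : ZMod p)) (fun x _ => x.val) (fun _ _ => Finset.mem_univ _)
      (fun x _ => Finset.mem_range.2 x.val_lt)
      (fun x hx => ZMod.val_cast_of_lt (Finset.mem_range.1 hx)) (fun x _ => ZMod.natCast_zmod_val x)
      fun x _ => ?_
    have h1 : G.eval (x : ZMod p) = ((g.eval (x : ℤ) : ℤ) : ZMod p) := by
      rw [hG, ← Int.cast_natCast x, eval_intCast_map]
      rfl
    rw [h1, ZMod.stdAddChar_coe, expChar, pow_one]
  rw [expSum_eq, hsum, norm_mul, pow_one, norm_inv, Complex.norm_natCast, Real.sqrt_inv]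
  have hp0 : (0 : ℝ) < p := Nat.cast_pos.2 hp.pos
  rw [inv_mul_le_iff₀ hp0]
  refine (weil_bound hψ G hG0).trans ?_
  have h2 : (p : ℝ) * (g.natDegree * (√p)⁻¹) = g.natDegree * √p := by
    have : (p : ℝ) = √p * √p := (Real.mul_self_sqrt hp0.le).symm
    have h3 : √(p : ℝ) ≠ 0 := (Real.sqrt_pos.2 hp0).ne'
    nth_rewrite 1 [this]
    field_simp
  rw [h2]
  gcongr

section Nonarchimedean

variable {K : Type*} [Field K] {v : AbsoluteValue K ℝ}

theorem IsNonarchimedean.sub_le_max (hna : IsNonarchimedean v) (x y : K) :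
    v (x - y) ≤ max (v x) (v y) := by
  simpa [sub_eq_add_neg] using hna x (-y)

theorem Polynomial.gaussNorm_X_sub_C (r : K) :
    (X - C r : K[X]).gaussNorm v 1 = max 1 (v r) := by
  have h1 := (X - C r : K[X]).le_gaussNorm v zero_le_one 1
  have h0 := (X - C r : K[X]).le_gaussNorm v zero_le_one 0
  simp at h1 h0
  refine le_antisymm ?_ (max_le h1 h0)
  obtain ⟨i, hi⟩ := exists_eq_gaussNorm v 1 (X - C r : K[X])
  rw [hi, one_pow, mul_one]
  rcases i with _ | _ | i
  · simp
  · simp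
  · simp [coeff_X]

theorem Polynomial.gaussNorm_C_mul_prod (hna : IsNonarchimedean v) {ι : Type*} (R : Finset ι)
    (e : ι → ℕ) (ρ : ι → K) (a : K) :
    (C a * ∏ i ∈ R, (X - C (ρ i)) ^ e i).gaussNorm v 1 =
      v a * ∏ i ∈ R, max 1 (v (ρ i)) ^ e i := by
  have hone : (1 : K[X]).gaussNorm v 1 = 1 := by
    rw [← C_1, gaussNorm_C, map_one]
  rw [gaussNorm_mul hna one_pos, gaussNorm_C]
  congr 1
  let N : K[X] →* ℝ :=
    { toFun := gaussNorm v 1, map_one' := hone, map_mul' := gaussNorm_mul hna one_pos }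
  change N _ = _
  rw [map_prod]
  refine Finset.prod_congr rfl fun i _ => ?_
  rw [map_pow]
  exact congrArg (· ^ e i) (gaussNorm_X_sub_C (ρ i))

theorem prod_max_one_le {ι : Type*} [DecidableEq ι] (hna : IsNonarchimedean v) (R : Finset ι)
    (e : ι → ℕ) (ρ : ι → K) (a : K) {i : ι} (hi : ∀ j ∈ R, v (ρ i) ≤ v (ρ j)) (s : Finset ι) :
    v (a * ∏ j ∈ R \ s, (ρ i - ρ j) ^ e j) ≤ v a * ∏ j ∈ R, max 1 (v (ρ j)) ^ e j := by
  rw [map_mul, map_prod]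
  refine mul_le_mul_of_nonneg_left ?_ (v.nonneg _)
  rw [← Finset.prod_sdiff (Finset.sdiff_subset : R \ s ⊆ R), mul_comm]
  refine (Finset.prod_le_prod (fun j _ => v.nonneg _) fun j hj => ?_).trans
    (le_mul_of_one_le_right (Finset.prod_nonneg fun j _ => by positivity) ?_)
  · rw [map_pow]
    refine pow_le_pow_left₀ (v.nonneg _) ((hna.sub_le_max _ _).trans ?_) _
    exact (max_le (hi j (Finset.mem_sdiff.1 hj).1) le_rfl).trans (le_max_right _ _)
  · exact Finset.one_le_prod fun j _ => one_le_pow₀ (le_max_left _ _)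

variable {p : ℕ} {ι : Type*} {R : Finset ι} {e : ι → ℕ} {ρ : ι → K} {a : K} {q : ℤ[X]}

theorem mul_prod_max_one_le_one (hna : IsNonarchimedean v) (hZ : ∀ n : ℤ, v n ≤ 1)
    (hq : q.map (Int.castRingHom K) = C a * ∏ i ∈ R, (X - C (ρ i)) ^ e i) :
    v a * ∏ i ∈ R, max 1 (v (ρ i)) ^ e i ≤ 1 := by
  rw [← gaussNorm_C_mul_prod hna, ← hq]
  obtain ⟨i, hi⟩ := exists_eq_gaussNorm v 1 (q.map (Int.castRingHom K))
  rw [hi, one_pow, mul_one, coeff_map]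
  exact hZ _

theorem one_le_mul_prod_max_one (hna : IsNonarchimedean v)
    (hZp : ∀ n : ℤ, ¬ (p : ℤ) ∣ n → v n = 1)
    (hq : q.map (Int.castRingHom K) = C a * ∏ i ∈ R, (X - C (ρ i)) ^ e i)
    (hqp : ¬ ∀ i, (p : ℤ) ∣ q.coeff i) :
    1 ≤ v a * ∏ i ∈ R, max 1 (v (ρ i)) ^ e i := by
  rw [← gaussNorm_C_mul_prod hna, ← hq]
  push Not at hqp
  obtain ⟨i, hi⟩ := hqp
  have := (q.map (Int.castRingHom K)).le_gaussNorm v zero_le_one i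
  rwa [one_pow, mul_one, coeff_map, eq_intCast, hZp _ hi] at this

theorem exists_root_sub_lt_one (hna : IsNonarchimedean v) (hZ : ∀ n : ℤ, v n ≤ 1)
    (hZp : ∀ n : ℤ, ¬ (p : ℤ) ∣ n → v n = 1) (hvp : v (p : K) < 1)
    (hq : q.map (Int.castRingHom K) = C a * ∏ i ∈ R, (X - C (ρ i)) ^ e i)
    (hqp : ¬ ∀ i, (p : ℤ) ∣ q.coeff i) {u : ℤ} (hu : (p : ℤ) ∣ q.eval u) :
    ∃ i ∈ R, v (ρ i - u) < 1 := by
  by_contra! hR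
  have h1 : v (q.eval u : ℤ) = v a * ∏ i ∈ R, v (ρ i - u) ^ e i := by
    have := congrArg (eval (u : K)) hq
    rw [eval_intCast_map, eq_intCast] at this
    rw [Int.cast_id] at this
    rw [this, eval_mul, eval_C, eval_prod, map_mul, map_prod]
    congr 1
    refine Finset.prod_congr rfl fun i _ => ?_
    rw [eval_pow, eval_sub, eval_X, eval_C, map_pow, v.map_sub]
  have h2 : v (q.eval u : ℤ) < 1 := by
    obtain ⟨k, hk⟩ := hu
    rw [hk, Int.cast_mul, map_mul, Int.cast_natCast]
    exact (mul_le_of_le_one_right (v.nonneg _) (hZ k)).trans_lt hvp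
  refine h2.not_ge ((one_le_mul_prod_max_one hna hZp hq hqp).trans ?_)
  rw [h1]
  gcongr with i hi
  refine max_le (hR i hi) ?_
  have := hna (ρ i - u) u
  rw [sub_add_cancel] at this
  exact this.trans (max_le le_rfl ((hZ u).trans (hR i hi)))

theorem sum_filter_ball_le (hna : IsNonarchimedean v) (hZ : ∀ n : ℤ, v n ≤ 1)
    (hZp : ∀ n : ℤ, ¬ (p : ℤ) ∣ n → v n = 1) (R : Finset ι) (e : ι → ℕ) (ρ : ι → K) :
    ∑ u ∈ Finset.range p, ∑ i ∈ R with v (ρ i - (u : ℤ)) < 1, e i ≤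
      ∑ i ∈ R with v (ρ i) ≤ 1, e i := by
  simp only [Finset.sum_filter]
  rw [Finset.sum_comm]
  refine Finset.sum_le_sum fun i _ => ?_
  rw [← Finset.sum_filter, Finset.sum_const, smul_eq_mul]
  by_cases hs : ((Finset.range p).filter fun u : ℕ => v (ρ i - (u : ℤ)) < 1) = ∅
  · rw [hs]; simp
  obtain ⟨u, hu⟩ := Finset.nonempty_iff_ne_empty.2 hs
  have hρ : v (ρ i) ≤ 1 := by
    have := hna (ρ i - (u : ℤ)) (u : ℤ)
    rw [sub_add_cancel] at this
    exact this.trans (max_le (Finset.mem_filter.1 hu).2.le (hZ u))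
  rw [if_pos hρ]
  refine mul_le_of_le_one_left (Nat.zero_le _) (Finset.card_le_one.2 fun x hx y hy => ?_)
  rw [Finset.mem_filter, Finset.mem_range] at hx hy
  have h1 : v ((x - y : ℤ) : K) < 1 := by
    have := hna.sub_le_max (ρ i - (y : ℤ)) (ρ i - (x : ℤ))
    rw [sub_sub_sub_cancel_left, ← Int.cast_sub] at this
    exact this.trans_lt (max_lt hy.2 hx.2)
  have h2 : (p : ℤ) ∣ x - y := by
    by_contra h
    exact h1.ne (hZp _ h)
  have h3 : (x : ℤ) - y = 0 := Int.eq_zero_of_abs_lt_dvd h2 (by rw [abs_lt]; omega)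
  omega

end Nonarchimedean

theorem natDegree_C_add_C_mul {c k : ℤ} (hk : k ≠ 0) (h : ℤ[X]) :
    (C c + C k * h).natDegree = h.natDegree := by
  rw [natDegree_C_add, natDegree_C_mul hk]

theorem derivative_eq_comp_of_comp_eq {k u c : ℤ} (hk : k ≠ 0) {g h : ℤ[X]}
    (hg : g.comp (C u + C k * X) = C c + C k * h) :
    derivative h = (derivative g).comp (C u + C k * X) := by
  have h1 := congrArg derivative hg
  simp only [derivative_comp, derivative_add, derivative_C, derivative_C_mul, derivative_X,
    mul_one, zero_add] at h1
  exact (mul_left_cancel₀ (C_ne_zero.2 hk) h1).symm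

theorem prod_comp_affine {K : Type*} [Field K] {ι : Type*} (R : Finset ι) (e : ι → ℕ) (ρ : ι → K)
    (a u : K) {k : K} (hk : k ≠ 0) :
    (C a * ∏ i ∈ R, (X - C (ρ i)) ^ e i).comp (C u + C k * X) =
      C (a * k ^ ∑ i ∈ R, e i) * ∏ i ∈ R, (X - C ((ρ i - u) / k)) ^ e i := by
  rw [mul_comp, C_comp, prod_comp, C_mul, mul_assoc]
  congr 1
  rw [← Finset.prod_pow_eq_pow_sum, map_prod, ← Finset.prod_mul_distrib]
  refine Finset.prod_congr rfl fun i _ => ?_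
  rw [pow_comp, sub_comp, X_comp, C_comp, C_pow, ← mul_pow, mul_sub, ← C_mul,
    mul_div_cancel₀ _ hk, C_sub]
  congr 1
  ring

section

variable {K : Type*} [Field K] {v : AbsoluteValue K ℝ} {p : ℕ}
  {ι : Type*} [DecidableEq ι] {R : Finset ι} {e : ι → ℕ}

/-- `B` is a radius at level `n` for the roots `ρ`: around every root there is a cluster on which
the stable bound at scale `p⁻ⁿ` is at most `B`. -/
def IsStableRadius (v : AbsoluteValue K ℝ) (p : ℕ) (R : Finset ι) (e : ι → ℕ) (ρ : ι → K) (a : K)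
    (n : ℕ) (B : ℝ) : Prop :=
  ∀ i ∈ R, ∃ s ⊆ R, i ∈ s ∧
    ((p : ℝ) ^ n)⁻¹ ≤ B ^ (∑ j ∈ s, e j + 1) * v (a * ∏ j ∈ R \ s, (ρ i - ρ j) ^ e j)

variable {ρ : ι → K} {a : K} {n : ℕ} {B : ℝ}

theorem IsStableRadius.inv_pow_le (hna : IsNonarchimedean v) (hZ : ∀ n : ℤ, v n ≤ 1)
    (hR : R.Nonempty) (he : ∀ i ∈ R, 1 ≤ e i) {q : ℤ[X]}
    (hq : q.map (Int.castRingHom K) = C a * ∏ i ∈ R, (X - C (ρ i)) ^ e i) (hB0 : 0 < B)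
    (h : IsStableRadius v p R e ρ a n B) : ∃ k : ℕ, ((p : ℝ) ^ n)⁻¹ ≤ B ^ (k + 2) := by
  obtain ⟨i, hi, hmin⟩ := R.exists_min_image (fun i => v (ρ i)) hR
  obtain ⟨s, hs, his, hB⟩ := h i hi
  have h1 : v (a * ∏ j ∈ R \ s, (ρ i - ρ j) ^ e j) ≤ 1 :=
    (prod_max_one_le hna R e ρ a hmin s).trans (mul_prod_max_one_le_one hna hZ hq)
  have h2 : 1 ≤ ∑ j ∈ s, e j := (he i hi).trans (Finset.single_le_sum_of_canonicallyOrdered his)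
  refine ⟨∑ j ∈ s, e j - 1, hB.trans ((mul_le_of_le_one_right (by positivity) h1).trans_eq ?_)⟩
  congr 1
  omega

variable [Fact p.Prime]

theorem IsStableRadius.div (hvp : v (p : K) = (p : ℝ)⁻¹) (h : IsStableRadius v p R e ρ a (n + 1) B) :
    IsStableRadius v p R e ρ (a / p) n B := by
  intro i hi
  obtain ⟨s, hs, his, hB⟩ := h i hi
  refine ⟨s, hs, his, ?_⟩
  have hp : (0 : ℝ) < p := Nat.cast_pos.2 (Fact.out : p.Prime).pos
  rw [div_mul_eq_mul_div, map_div₀, hvp, div_inv_eq_mul, ← mul_assoc]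
  rw [pow_succ, mul_inv, ← div_eq_mul_inv, div_le_iff₀ hp] at hB
  exact hB

theorem IsStableRadius.rescale (hvp : v (p : K) = (p : ℝ)⁻¹)
    (h : IsStableRadius v p R e ρ a (n + 1) B) (u : K) :
    IsStableRadius v p R e (fun i => (ρ i - u) / p) (a * (p : K) ^ ∑ i ∈ R, e i) n (p * B) := by
  intro i hi
  obtain ⟨s, hs, his, hB⟩ := h i hi
  refine ⟨s, hs, his, ?_⟩
  have hp : (0 : ℝ) < p := Nat.cast_pos.2 (Fact.out : p.Prime).pos
  have hpK : (p : K) ≠ 0 := by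
    rintro h0
    rw [h0, map_zero, eq_comm, inv_eq_zero] at hvp
    exact hp.ne' hvp
  have h2 : ∏ j ∈ R \ s, ((ρ i - u) / p - (ρ j - u) / p) ^ e j =
      (∏ j ∈ R \ s, (ρ i - ρ j) ^ e j) / (p : K) ^ ∑ j ∈ R \ s, e j := by
    rw [← Finset.prod_pow_eq_pow_sum, ← Finset.prod_div_distrib]
    refine Finset.prod_congr rfl fun j _ => ?_
    rw [← div_pow]
    congr 1
    ring
  have h3 : a * (p : K) ^ (∑ i ∈ R, e i) *
      ∏ j ∈ R \ s, ((ρ i - u) / p - (ρ j - u) / p) ^ e j =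
        (p : K) ^ (∑ j ∈ s, e j) * (a * ∏ j ∈ R \ s, (ρ i - ρ j) ^ e j) := by
    rw [h2, ← Finset.sum_sdiff hs, pow_add]
    field_simp
  rw [h3, map_mul, map_pow, hvp, mul_pow]
  rw [pow_succ, mul_inv, ← div_eq_mul_inv, div_le_iff₀ hp] at hB
  refine hB.trans_eq ?_
  rw [pow_succ (p : ℝ), inv_pow]
  field_simp

theorem norm_expSum_le_of_isStableRadius (hna : IsNonarchimedean v) (hZ : ∀ n : ℤ, v n ≤ 1)
    (hZp : ∀ n : ℤ, ¬ (p : ℤ) ∣ n → v n = 1) (hvp : v (p : K) = (p : ℝ)⁻¹)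
    (hR : R.Nonempty) (he : ∀ i ∈ R, 1 ≤ e i) {d : ℕ} (hd : 1 ≤ d) (hdp : d < p) (n : ℕ) :
    ∀ (g : ℤ[X]) (ρ : ι → K) (a : K) (B : ℝ), g.natDegree ≤ d →
      (derivative g).map (Int.castRingHom K) = C a * ∏ i ∈ R, (X - C (ρ i)) ^ e i →
      0 < B → IsStableRadius v p R e ρ a n B →
      ‖expSum p n g‖ ≤ d * (max 1 (∑ i ∈ R with v (ρ i) < p, e i) : ℕ) * B := by
  have hpp : p.Prime := Fact.out
  have hp : p ≠ 0 := hpp.ne_zero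
  have hpZ : (p : ℤ) ≠ 0 := Nat.cast_ne_zero.2 hp
  have hpR : (0 : ℝ) < p := Nat.cast_pos.2 hpp.pos
  have hp1 : (1 : ℝ) < p := Nat.one_lt_cast.2 hpp.one_lt
  have hpK : (p : K) ≠ 0 := by
    rintro h0
    rw [h0, map_zero, eq_comm, inv_eq_zero] at hvp
    exact hpR.ne' hvp
  have hvp1 : v (p : K) < 1 := hvp ▸ inv_lt_one_of_one_lt₀ hp1
  have hd' : (1 : ℝ) ≤ d := Nat.one_le_cast.2 hd
  have hmax : ∀ N : ℕ, (1 : ℝ) ≤ (max 1 N : ℕ) := fun N => Nat.one_le_cast.2 (le_max_left _ _)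
  have hdB : ∀ (N : ℕ) {B : ℝ}, 0 < B → d * B ≤ d * (max 1 N : ℕ) * B := fun N B hB => by
    refine mul_le_mul_of_nonneg_right ?_ hB.le
    exact le_mul_of_one_le_right (by positivity) (hmax N)
  have htriv : ∀ (m : ℕ) (g : ℤ[X]) (N : ℕ) {B : ℝ}, 1 ≤ B →
      ‖expSum p m g‖ ≤ d * (max 1 N : ℕ) * B := fun m g N B hB =>
    (norm_expSum_le_one hp m g).trans
      ((one_le_mul_of_one_le_of_one_le hd' hB).trans (hdB N (one_pos.trans_le hB)))
  induction n with
  | zero =>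
    intro g ρ a B _ hg hB h
    obtain ⟨k, hk⟩ := h.inv_pow_le hna hZ hR he hg hB
    refine htriv 0 g _ ?_
    by_contra! hB1
    rw [pow_zero, inv_one] at hk
    exact (pow_lt_one₀ hB.le hB1 (by omega)).not_ge hk
  | succ n ih =>
    intro g ρ a B hgd hg hB h
    by_cases hdvd : ∀ i, (p : ℤ) ∣ (derivative g).coeff i
    · obtain ⟨g', hg'⟩ := exists_eq_C_add_C_mul hpp (hgd.trans_lt hdp) hdvd
      have hdeg : g'.natDegree ≤ d := by
        rwa [hg', natDegree_C_add_C_mul hpZ] at hgd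
      rw [hg', norm_expSum_C_add_C_mul hp]
      refine ih g' ρ (a / p) B hdeg ?_ hB (h.div hvp)
      have h1 := congrArg derivative hg'
      rw [derivative_add, derivative_C, zero_add, derivative_C_mul] at h1
      rw [h1, Polynomial.map_mul, map_C, eq_intCast, Int.cast_natCast] at hg
      have h2 : C a = C (p : K) * C (a / p) := by rw [← C_mul, mul_div_cancel₀ _ hpK]
      rw [h2, mul_assoc] at hg
      exact mul_left_cancel₀ (C_ne_zero.2 hpK) hg
    rcases Nat.eq_zero_or_pos n with rfl | hn
    · by_cases hB1 : 1 ≤ B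
      · exact htriv _ _ _ hB1
      obtain ⟨k, hk⟩ := h.inv_pow_le hna hZ hR he hg hB
      have h1 : √(p : ℝ)⁻¹ ≤ B := by
        rw [Real.sqrt_le_left hB.le]
        rw [zero_add, pow_one] at hk
        exact hk.trans (pow_le_pow_of_le_one hB.le (not_le.1 hB1).le (by omega))
      refine (norm_expSum_one_le (hgd.trans_lt hdp) hdvd).trans (le_trans ?_ (hdB _ hB))
      gcongr
    · obtain ⟨n, rfl⟩ := Nat.exists_eq_add_one.2 hn
      choose r hr using fun u : ℕ => exists_comp_eq p g u
      set h' : ℕ → ℤ[X] := fun u => C ((derivative g).eval (u : ℤ)) * X + C (p : ℤ) * r u with hh'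
      have hbound : ∀ u ∈ Finset.range p, ‖expSum p (n + 1) (h' u)‖ ≤
          d * (∑ i ∈ R with v (ρ i - (u : ℤ)) < 1, e i : ℕ) * (p * B) := by
        intro u _
        by_cases hu : (p : ℤ) ∣ (derivative g).eval (u : ℤ)
        · obtain ⟨i, hi, hiu⟩ := exists_root_sub_lt_one hna hZ hZp hvp1 hg hdvd hu
          have hdeg : (h' u).natDegree ≤ d := by
            rw [← natDegree_C_add_C_mul (c := g.eval (u : ℤ)) hpZ, ← hr u]
            refine natDegree_comp_le.trans ((Nat.mul_le_mul hgd ?_).trans_eq (mul_one d))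
            rw [natDegree_C_add]
            exact (natDegree_C_mul_le _ _).trans natDegree_X_le
          have h1 := ih (h' u) (fun i => (ρ i - (u : ℤ)) / p) (a * (p : K) ^ ∑ i ∈ R, e i) (p * B)
            hdeg ?_ (by positivity) (h.rescale hvp _)
          · have hfilter : (R.filter fun i => v ((ρ i - (u : ℤ)) / p) < p) =
                R.filter fun i => v (ρ i - (u : ℤ)) < 1 := by
              refine Finset.filter_congr fun i _ => ?_
              rw [map_div₀, hvp, div_inv_eq_mul, mul_lt_iff_lt_one_left hpR]
            rw [hfilter, max_eq_right] at h1
            · exact h1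
            · exact (he i hi).trans (Finset.single_le_sum_of_canonicallyOrdered
                (Finset.mem_filter.2 ⟨hi, hiu⟩))
          · rw [derivative_eq_comp_of_comp_eq hpZ (hr u), Polynomial.map_comp, hg]
            rw [← prod_comp_affine R e ρ a _ hpK]
            simp
        · rw [hh', expSum_C_mul_X_add_eq_zero hp n hu, norm_zero]
          positivity
      refine (norm_expSum_succ_le hp _ g _ h' hr).trans ?_
      rw [inv_mul_le_iff₀ hpR]
      refine (Finset.sum_le_sum hbound).trans ?_
      rw [← Finset.sum_mul, ← Finset.mul_sum, ← Nat.cast_sum, mul_left_comm]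
      refine mul_le_mul_of_nonneg_left ?_ hpR.le
      gcongr
      refine (sum_filter_ball_le hna hZ hZp R e ρ).trans (le_trans ?_ (le_max_right _ _))
      refine Finset.sum_le_sum_of_subset fun i hi => ?_
      rw [Finset.mem_filter] at hi ⊢
      exact ⟨hi.1, hi.2.trans_lt hp1⟩

end

/-- Phong–Stein type stable bound (Proposition 1.3 applied to complete exponential sums):
for `d ≥ 2` there is `C_d > 0` such that for each prime `p > d`, each `f ∈ ℤ[X]` of degree `d`
and each `m ≥ 1`, if `f'` factors completely over a nonarchimedean valued field `K ⊇ ℚ_p` as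
`f' = a ∏_{ξ∈R} (X-ξ)^{e_ξ}`, then
`|S_m(f)| ≤ C_d · max_{ξ∈R} min_{C ∋ ξ} (p^{-m}/|a ∏_{η∉C} (ξ-η)^{e_η}|)^{1/(S(C)+1)}`,
formulated as: there is a root `ξ ∈ R` such that the bound holds for every subset
`C ⊆ R` containing `ξ`. -/
theorem phong_stein_bound (d : ℕ) (hd : 2 ≤ d) :
    ∃ C : ℝ, 0 < C ∧
      ∀ (p : ℕ) [Fact p.Prime], d < p →
        ∀ (K : Type) [Field K] [Algebra ℚ_[p] K] [DecidableEq K] (v : AbsoluteValue K ℝ),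
          (∀ x y : K, v (x + y) ≤ max (v x) (v y)) →
          (∀ x : ℚ_[p], v (algebraMap ℚ_[p] K x) = ‖x‖) →
          ∀ (f : Polynomial ℤ), f.natDegree = d →
            ∀ m : ℕ, 1 ≤ m →
              ∀ (R : Finset K) (e : K → ℕ) (a : K),
                (∀ ξ ∈ R, 1 ≤ e ξ) →
                a = ((derivative f).leadingCoeff : K) →
                (derivative f).map (Int.castRingHom K) =
                  Polynomial.C a * ∏ ξ ∈ R, (Polynomial.X - Polynomial.C ξ) ^ e ξ →
                ∃ ξ ∈ R, ∀ Cs : Finset K, Cs ⊆ R → ξ ∈ Cs →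
                  ‖expSum p m f‖ ≤
                    C * (((p : ℝ) ^ m)⁻¹ / v (a * ∏ η ∈ R \ Cs, (ξ - η) ^ e η)) ^
                      ((1 : ℝ) / (((∑ η ∈ Cs, e η : ℕ) : ℝ) + 1)) := by
  refine ⟨d * d, by positivity, ?_⟩
  intro p _ hdp K _ _ _ v hna' hv f hf m _ R e a he ha hfac
  have hna : IsNonarchimedean v := hna'
  have hpp : p.Prime := Fact.out
  have hp0 : (0 : ℝ) < p := Nat.cast_pos.2 hpp.pos
  have hint : ∀ n : ℤ, v (n : K) = ‖(n : ℚ_[p])‖ := fun n => by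
    rw [← hv, map_intCast (algebraMap ℚ_[p] K)]
  have hZ : ∀ n : ℤ, v (n : K) ≤ 1 := fun n => (hint n).trans_le (Padic.norm_int_le_one n)
  have hZp : ∀ n : ℤ, ¬ (p : ℤ) ∣ n → v (n : K) = 1 := fun n hn => by
    refine le_antisymm (hZ n) (not_lt.1 fun h => hn ?_)
    rw [hint] at h
    exact Padic.norm_intCast_lt_one_iff.1 h
  have hvp : v (p : K) = (p : ℝ)⁻¹ := by
    have := hint p
    rwa [Int.cast_natCast, Int.cast_natCast, Padic.norm_p] at this
  have : CharZero K := charZero_of_injective_algebraMap (algebraMap ℚ_[p] K).injective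
  have hdf : derivative f ≠ 0 := by
    intro h
    have := derivative_eq_zero.1 h
    omega
  have ha0 : a ≠ 0 := by
    rw [ha]
    exact Int.cast_ne_zero.2 (leadingCoeff_ne_zero.2 hdf)
  have hsum : ∑ ξ ∈ R, e ξ = d - 1 := by
    have h1 := congrArg natDegree hfac
    rw [natDegree_map_eq_of_injective (Int.castRingHom K).injective_int, natDegree_derivative,
      hf, natDegree_C_mul ha0, natDegree_prod_of_monic _ _ fun ξ _ => (monic_X_sub_C ξ).pow _] at h1
    simpa using h1.symm
  have hR : R.Nonempty := by
    rw [Finset.nonempty_iff_ne_empty]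
    rintro rfl
    rw [Finset.sum_empty] at hsum
    omega
  by_contra! hcon
  choose! s hsR hsmem hs using hcon
  have hv0 : ∀ ξ ∈ R, 0 < v (a * ∏ η ∈ R \ s ξ, (ξ - η) ^ e η) := fun ξ hξ => by
    refine v.pos (mul_ne_zero ha0 (Finset.prod_ne_zero_iff.2 fun η hη => pow_ne_zero _ ?_))
    rintro h
    rw [← sub_eq_zero.1 h] at hη
    exact (Finset.mem_sdiff.1 hη).2 (hsmem ξ hξ)
  set T : K → ℝ := fun ξ => (((p : ℝ) ^ m)⁻¹ / v (a * ∏ η ∈ R \ s ξ, (ξ - η) ^ e η)) ^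
    ((1 : ℝ) / (((∑ η ∈ s ξ, e η : ℕ) : ℝ) + 1)) with hT
  have hT0 : ∀ ξ ∈ R, 0 < T ξ := fun ξ hξ => by
    have := hv0 ξ hξ
    positivity
  obtain ⟨ξ₀, hξ₀, hmax⟩ := R.exists_max_image T hR
  have hrad : IsStableRadius v p R e id a m (T ξ₀) := by
    intro ξ hξ
    refine ⟨s ξ, hsR ξ hξ, hsmem ξ hξ, ?_⟩
    refine (div_le_iff₀ (hv0 ξ hξ)).1 ?_
    refine le_trans (le_of_eq ?_) (pow_le_pow_left₀ (hT0 ξ hξ).le (hmax ξ hξ) _)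
    have hnonneg : 0 ≤ ((p : ℝ) ^ m)⁻¹ / v (a * ∏ η ∈ R \ s ξ, (ξ - η) ^ e η) := by
      have := hv0 ξ hξ
      positivity
    have h1 := Real.rpow_inv_natCast_pow hnonneg (∑ η ∈ s ξ, e η).succ_ne_zero
    rw [Nat.cast_succ, ← one_div (_ + 1 : ℝ)] at h1
    exact h1.symm
  refine (hs ξ₀ hξ₀).not_ge ((norm_expSum_le_of_isStableRadius hna hZ hZp hvp hR he
    (one_le_two.trans hd) hdp m f id a (T ξ₀) hf.le hfac (hT0 ξ₀ hξ₀) hrad).trans ?_)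
  have hN : max 1 (∑ ξ ∈ R with v (id ξ) < p, e ξ) ≤ d := by
    refine max_le (one_le_two.trans hd)
      ((Finset.sum_le_sum_of_subset (Finset.filter_subset _ _)).trans ?_)
    omega
  have := (hT0 ξ₀ hξ₀).le
  gcongr
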